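/- arXiv:1812.11618 — 4 statements merged into one kernel-verified Lean document; each statement's English description precedes it below -/
import Mathlib

section
/- Let A be a complex Banach algebra with identity, let a, b ∈ A each have a generalized Hirano inverse with ab = ba, and let x ∈ A be a g-Drazin inverse of a. If 1 + xb has a generalized Hirano inverse, then a + b has a generalized Hirano inverse. -/
/-- `a` is quasinilpotent: `1 + a*x` is invertible for every `x` commuting with `a`. -/
def Quasinilpotent {A : Type*} [Ring A] (a : A) : Prop :=
  ∀ x : A, x * a = a * x → IsUnit (1 + a * x)

/-- `b` is a g-Drazin inverse of `a`. -/
def IsGDrazinInv {A : Type*} [Ring A] (a b : A) : Prop :=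
  b = b * a * b ∧ a * b = b * a ∧ Quasinilpotent (a - a ^ 2 * b)

/-- `b` is a gs-Drazin inverse of `a`. -/
def IsGSDrazinInv {A : Type*} [Ring A] (a b : A) : Prop :=
  b = b * a * b ∧ a * b = b * a ∧ Quasinilpotent (a - a * b)

/-- `b` is a generalized Hirano inverse of `a`. -/
def IsGenHiranoInv {A : Type*} [Ring A] (a b : A) : Prop :=
  b = b * a * b ∧ a * b = b * a ∧ Quasinilpotent (a ^ 2 - a * b)

open Filter Topology

theorem small_of_units {A : Type*} [NormedRing A] [NormedAlgebra ℂ A] [CompleteSpace A] (t : A)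
    (h : ∀ l : ℂ, IsUnit (1 + l • t)) (C : ℝ) (hC : 0 < C) :
    Tendsto (fun n : ℕ => C ^ n * ‖t ^ n‖) atTop (𝓝 0) := by
  have hr : spectralRadius ℂ t = 0 := by
    unfold spectralRadius
    simp only [ENNReal.iSup_eq_zero]
    intro k hk
    by_cases hk0 : k = 0
    · simp [hk0]
    · exfalso
      apply spectrum.mem_iff.mp hk
      have h1 := h (-k⁻¹)
      have h2 : algebraMap ℂ A k - t = algebraMap ℂ A k * (1 + (-k⁻¹) • t) := by
        rw [mul_add, mul_one, Algebra.algebraMap_eq_smul_one, smul_mul_assoc, one_mul, smul_smul]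
        simp [hk0, sub_eq_add_neg]
      rw [h2]
      exact ((Ne.isUnit hk0).map (algebraMap ℂ A)).mul h1
  have hg := spectrum.pow_norm_pow_one_div_tendsto_nhds_spectralRadius t
  rw [hr] at hg
  have hpos : (0 : ENNReal) < ENNReal.ofReal (1 / (2 * C)) := by
    rw [ENNReal.ofReal_pos]; positivity
  have hev := hg.eventually (gt_mem_nhds hpos)
  have hhalf : Tendsto (fun n : ℕ => ((1 : ℝ) / 2) ^ n) atTop (𝓝 0) :=
    tendsto_pow_atTop_nhds_zero_of_lt_one (by norm_num) (by norm_num)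
  refine squeeze_zero' (Eventually.of_forall fun n => by positivity) ?_ hhalf
  filter_upwards [hev, eventually_gt_atTop 0] with n hn hn0
  have h1 : ‖t ^ n‖ ^ (1 / n : ℝ) < 1 / (2 * C) :=
    (ENNReal.ofReal_lt_ofReal_iff (by positivity)).mp hn
  have h2 : ‖t ^ n‖ ≤ (1 / (2 * C)) ^ n := by
    have h3 : (‖t ^ n‖ ^ (1 / n : ℝ)) ^ n ≤ (1 / (2 * C)) ^ n :=
      pow_le_pow_left₀ (by positivity) h1.le n
    rwa [one_div, Real.rpow_inv_natCast_pow (norm_nonneg _) hn0.ne'] at h3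
  calc C ^ n * ‖t ^ n‖ ≤ C ^ n * (1 / (2 * C)) ^ n := by gcongr
    _ = (1 / 2) ^ n := by
      rw [← mul_pow]; congr 1; field_simp

theorem Quasinilpotent.units {A : Type*} [NormedRing A] [NormedAlgebra ℂ A] {t : A}
    (h : Quasinilpotent t) (l : ℂ) : IsUnit (1 + l • t) := by
  have := h (algebraMap ℂ A l) (Algebra.commutes l t)
  rwa [← Algebra.commutes, ← Algebra.smul_def] at this

theorem quasinilpotent_of_units {A : Type*} [NormedRing A] [NormedAlgebra ℂ A] [CompleteSpace A]
    (t : A) (h : ∀ l : ℂ, IsUnit (1 + l • t)) : Quasinilpotent t := by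
  intro x hx
  have hs := small_of_units t h (‖x‖ + 1) (by positivity)
  obtain ⟨n, hn, hn0⟩ := ((hs.eventually (gt_mem_nhds (zero_lt_one))).and
    (eventually_gt_atTop 0)).exists
  have hc : Commute t x := hx.symm
  have hlt : ‖(-(t * x)) ^ n‖ < 1 := by
    have h1 : (-(t * x)) ^ n = t ^ n * (-x) ^ n := by
      rw [← mul_neg, (hc.neg_right).mul_pow]
    calc ‖(-(t * x)) ^ n‖ ≤ ‖t ^ n‖ * ‖(-x) ^ n‖ := by rw [h1]; exact norm_mul_le _ _
      _ ≤ ‖t ^ n‖ * (‖x‖ + 1) ^ n := by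
        gcongr
        refine (norm_pow_le' (-x) hn0).trans ?_
        rw [norm_neg]
        gcongr
        linarith
      _ < 1 := by rwa [mul_comm]
  have hu : IsUnit (1 - (-(t * x)) ^ n) := isUnit_one_sub_of_norm_lt_one hlt
  have h1 := mul_neg_geom_sum (-(t * x)) n
  have h2 := geom_sum_mul_neg (-(t * x)) n
  rw [← h1, (show Commute (1 - -(t * x)) _ from h1.trans h2.symm).isUnit_mul_iff] at hu
  simpa using hu.1

theorem zero_of_left {A : Type*} [NormedRing A] [NormedAlgebra ℂ A] [CompleteSpace A]
    (t y d : A) (h : Quasinilpotent t) (hd : d = y * d * t) : d = 0 := by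
  have hn : ∀ n : ℕ, d = y ^ n * d * t ^ n := by
    intro n
    induction n with
    | zero => simp
    | succ n ih =>
      calc d = y ^ n * d * t ^ n := ih
        _ = y ^ n * (y * d * t) * t ^ n := by rw [← hd]
        _ = _ := by rw [pow_succ y, pow_succ' t]; noncomm_ring
  have hs := (small_of_units t h.units (‖y‖ + 1) (by positivity)).mul_const ‖d‖
  rw [zero_mul] at hs
  have : ‖d‖ ≤ 0 := by
    refine ge_of_tendsto hs ?_
    filter_upwards [eventually_gt_atTop 0] with n hn0
    calc ‖d‖ = ‖y ^ n * d * t ^ n‖ := by rw [← hn n]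
      _ ≤ ‖y ^ n‖ * ‖d‖ * ‖t ^ n‖ := norm_mul₃_le
      _ ≤ (‖y‖ + 1) ^ n * ‖d‖ * ‖t ^ n‖ := by
        gcongr
        exact (norm_pow_le' y hn0).trans (by gcongr; linarith)
      _ = _ := by ring
  simpa using this

theorem zero_of_right {A : Type*} [NormedRing A] [NormedAlgebra ℂ A] [CompleteSpace A]
    (t y d : A) (h : Quasinilpotent t) (hd : d = t * d * y) : d = 0 := by
  have hn : ∀ n : ℕ, d = t ^ n * d * y ^ n := by
    intro n
    induction n with
    | zero => simp
    | succ n ih =>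
      calc d = t ^ n * d * y ^ n := ih
        _ = t ^ n * (t * d * y) * y ^ n := by rw [← hd]
        _ = _ := by rw [pow_succ t, pow_succ' y]; noncomm_ring
  have hs := (small_of_units t h.units (‖y‖ + 1) (by positivity)).mul_const ‖d‖
  rw [zero_mul] at hs
  have : ‖d‖ ≤ 0 := by
    refine ge_of_tendsto hs ?_
    filter_upwards [eventually_gt_atTop 0] with n hn0
    calc ‖d‖ = ‖t ^ n * d * y ^ n‖ := by rw [← hn n]
      _ ≤ ‖t ^ n‖ * ‖d‖ * ‖y ^ n‖ := norm_mul₃_le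
      _ ≤ ‖t ^ n‖ * ‖d‖ * (‖y‖ + 1) ^ n := by
        gcongr
        exact (norm_pow_le' y hn0).trans (by gcongr; linarith)
      _ = _ := by ring
  simpa using this

/-- The core commutation lemma. -/
theorem idem_comm {A : Type*} [NormedRing A] [NormedAlgebra ℂ A] [CompleteSpace A]
    (a y p t c : A) (h1 : a * y = p) (h2 : y * a = p) (hp : p * p = p)
    (ht : Quasinilpotent t) (hl : (1 - p) * t = a * (1 - p)) (hr : t * (1 - p) = (1 - p) * t)
    (hc : c * a = a * c) : p * c = c * p := by
  have hap : a * p = p * a := by rw [← h1, mul_assoc, h2, ← h1, ← mul_assoc]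
  have e1 : p * c * (1 - p) = 0 := by
    apply zero_of_left t y _ ht
    calc p * c * (1 - p) = p * p * c * (1 - p) := by rw [hp]
      _ = y * (a * p) * c * (1 - p) := by rw [← mul_assoc, h2]
      _ = y * p * (a * c) * (1 - p) := by rw [hap]; noncomm_ring
      _ = y * p * c * (a * (1 - p)) := by rw [← hc]; noncomm_ring
      _ = y * (p * c * (1 - p)) * t := by rw [← hl]; noncomm_ring
  have e2 : (1 - p) * c * p = 0 := by
    apply zero_of_right t y _ ht
    have hl' : t * (1 - p) = (1 - p) * a := by
      rw [hr, hl, mul_sub, sub_mul, hap, mul_one, one_mul]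
    calc (1 - p) * c * p = (1 - p) * c * (p * p) := by rw [hp]
      _ = (1 - p) * c * (a * p * y) := by rw [hap, mul_assoc p, h1]
      _ = (1 - p) * (c * a) * p * y := by noncomm_ring
      _ = ((1 - p) * a) * c * p * y := by rw [hc]; noncomm_ring
      _ = t * ((1 - p) * c * p) * y := by rw [← hl']; noncomm_ring
  have e3 : p * c = p * c * p := by
    rw [mul_sub, mul_one, sub_eq_zero] at e1; exact e1
  have e4 : c * p = p * c * p := by
    rw [sub_mul, sub_mul, one_mul, sub_eq_zero] at e2; exact e2
  rw [e3, ← e4]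

theorem inv_comm {A : Type*} [Ring A] (a y c : A) (h : y = y * a * y) (h2 : a * y = y * a)
    (hc : c * a = a * c) (hp : a * y * c = c * (a * y)) : y * c = c * y := by
  calc y * c = y * (a * y * c) := by rw [← mul_assoc, ← mul_assoc, ← h]
    _ = y * (c * a) * y := by rw [hp]; noncomm_ring
    _ = (y * a) * c * y := by rw [hc]; noncomm_ring
    _ = c * (a * y) * y := by rw [← h2, hp]
    _ = c * (y * a * y) := by rw [h2]; noncomm_ring
    _ = c * y := by rw [← h]

theorem idem_aux {A : Type*} [Ring A] {a y : A} (h : y = y * a * y) :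
    a * y * (a * y) = a * y := by
  calc a * y * (a * y) = a * (y * a * y) := by noncomm_ring
    _ = a * y := by rw [← h]

theorem IsGDrazinInv.comm {A : Type*} [NormedRing A] [NormedAlgebra ℂ A] [CompleteSpace A]
    {a y : A} (h : IsGDrazinInv a y) (c : A) (hc : c * a = a * c) : y * c = c * y := by
  obtain ⟨h1, h2, h3⟩ := h
  have hp := idem_aux h1
  have hap : a * (a * y) = a * y * a := by rw [mul_assoc, ← h2]
  have ht : a - a ^ 2 * y = a * (1 - a * y) := by noncomm_ring
  have hcm : a * (1 - a * y) = (1 - a * y) * a := by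
    rw [mul_sub, sub_mul, hap, mul_one, one_mul]
  have hi : (1 - a * y) * (1 - a * y) = 1 - a * y := by
    rw [mul_sub, sub_mul _ _ (a * y), hp]; simp
  rw [ht] at h3
  refine inv_comm a y c h1 h2 hc (idem_comm a y (a * y) _ c rfl h2.symm hp h3 ?_ ?_ hc)
  · rw [← mul_assoc, ← hcm, mul_assoc, hi]
  · rw [← mul_assoc, ← hcm]

theorem IsGenHiranoInv.comm {A : Type*} [NormedRing A] [NormedAlgebra ℂ A] [CompleteSpace A]
    {a y : A} (h : IsGenHiranoInv a y) (c : A) (hc : c * a = a * c) : y * c = c * y := by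
  obtain ⟨h1, h2, h3⟩ := h
  have hp := idem_aux h1
  have hap : a * (a * y) = a * y * a := by rw [mul_assoc, ← h2]
  have hp2 : (a ^ 2) * (y ^ 2) = a * y := by
    calc (a ^ 2) * (y ^ 2) = a * (a * y) * y := by noncomm_ring
      _ = a * y * (a * y) := by rw [hap]; noncomm_ring
      _ = _ := hp
  have hp3 : (y ^ 2) * (a ^ 2) = a * y := by
    rw [← hp2]
    exact ((show Commute a y from h2).pow_pow 2 2).symm
  have hcm : a ^ 2 * (a * y) = (a * y) * a ^ 2 := by
    rw [pow_two, mul_assoc, hap, ← mul_assoc, hap, mul_assoc]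
  refine inv_comm a y c h1 h2 hc
    (idem_comm (a ^ 2) (y ^ 2) (a * y) _ c hp2 hp3 hp h3 ?_ ?_ ?_)
  · rw [mul_sub, sub_mul, sub_mul, hp, mul_sub, hcm]; simp
  · simp only [mul_sub, sub_mul, hcm, mul_one, one_mul]; abel
  · exact (show Commute c a from hc).pow_right 2

/-- Commuting elements lie in a commutative inverse-closed subalgebra. -/
theorem exists_comm_subalgebra {A : Type*} [Ring A] [Algebra ℂ A] (S : Set A)
    (hS : ∀ u ∈ S, ∀ v ∈ S, u * v = v * u) :
    ∃ R : Subalgebra ℂ A, S ⊆ R ∧ (∀ u ∈ R, ∀ v ∈ R, u * v = v * u) ∧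
      ∀ u ∈ R, ∀ v, u * v = 1 → v * u = 1 → v ∈ R := by
  refine ⟨Subalgebra.centralizer ℂ (Set.centralizer S), ?_, ?_, ?_⟩
  · exact Set.subset_centralizer_centralizer
  · intro u hu v hv
    rw [Subalgebra.mem_centralizer_iff] at hu hv
    apply hv u ?_ 
    rw [Set.mem_centralizer_iff]
    intro m hm
    apply hu
    rw [Set.mem_centralizer_iff]
    exact fun k hk => hS k hk m hm
  · intro u hu v huv hvu
    rw [Subalgebra.mem_centralizer_iff] at hu ⊢
    intro g hg
    calc g * v = v * (u * g) * v := by rw [← mul_assoc v, hvu, one_mul]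
      _ = v * g * (u * v) := by rw [← hu g hg]; noncomm_ring
      _ = v * g := by rw [huv, mul_one]

theorem field_case {K : Type*} [Field K] [CharZero K] (a b x y z w : K)
    (hy : y = y * a * y) (ha : a ^ 2 - a * y = 0) (hz : z = z * b * z) (hb : b ^ 2 - b * z = 0)
    (hx : x = x * a * x) (hx2 : a - a ^ 2 * x = 0)
    (hw : w = w * (1 + x * b) * w) (hw2 : (1 + x * b) ^ 2 - (1 + x * b) * w = 0) :
    (a + b) ^ 2 - ((1 - a * y) * (b * z) + a * y * (1 - b * z)) = 0 := by
  have key : ∀ u v : K, v = v * u * v → u ^ 2 - u * v = 0 → u = 0 ∨ u = 1 ∨ u = -1 := by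
    intro u v h1 h2
    by_cases hu : u = 0
    · exact Or.inl hu
    · have : u = v := mul_left_cancel₀ hu (by linear_combination h2)
      subst this
      have : u * ((u - 1) * (u + 1)) = 0 := by linear_combination -h1
      rcases mul_eq_zero.mp this with h | h
      · exact Or.inl h
      · rcases mul_eq_zero.mp h with h | h
        · exact Or.inr (Or.inl (by linear_combination h))
        · exact Or.inr (Or.inr (by linear_combination h))
  have hc := key _ _ hw hw2
  have e1 : a * y = a ^ 2 := by linear_combination -ha
  have e2 : b * z = b ^ 2 := by linear_combination -hb
  rw [e1, e2]
  rcases key a y hy ha with rfl | rfl | rfl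
  · ring
  · have : x = 1 := by linear_combination -hx2
    subst this
    rcases key b z hz hb with rfl | rfl | rfl
    · ring
    · norm_num at hc
    · ring
  · have : x = -1 := by linear_combination -hx2
    subst this
    rcases key b z hz hb with rfl | rfl | rfl
    · ring
    · ring
    · norm_num at hc

theorem comm_case {R : Type*} [CommRing R] [Algebra ℂ R] (a b x y z w : R)
    (hy : y = y * a * y) (ha : a ^ 2 - a * y ∈ Ideal.jacobson (⊥ : Ideal R))
    (hz : z = z * b * z) (hb : b ^ 2 - b * z ∈ Ideal.jacobson (⊥ : Ideal R))
    (hx : x = x * a * x) (hx2 : a - a ^ 2 * x ∈ Ideal.jacobson (⊥ : Ideal R))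
    (hw : w = w * (1 + x * b) * w)
    (hw2 : (1 + x * b) ^ 2 - (1 + x * b) * w ∈ Ideal.jacobson (⊥ : Ideal R)) :
    ∃ v : R, v = v * (a + b) * v ∧
      (a + b) ^ 2 - (a + b) * v ∈ Ideal.jacobson (⊥ : Ideal R) := by
  set e := (1 - a * y) * (b * z) + a * y * (1 - b * z) with he
  have hee : e * e = e := by
    have h1 : (a * y) * (a * y) = a * y := idem_aux hy
    have h2 : (b * z) * (b * z) = b * z := idem_aux hz
    rw [he]
    generalize a * y = p at *
    generalize b * z = q at *
    linear_combination (1 - 4 * q + 4 * q * q) * h1 + (1 + 0 * p) * h2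
  have hj : (a + b) ^ 2 - e ∈ Ideal.jacobson (⊥ : Ideal R) := by
    rw [Ideal.jacobson, Submodule.mem_sInf] at *
    rintro M ⟨hM0, hM⟩
    letI : Field (R ⧸ M) := Ideal.Quotient.field M
    haveI : CharZero (R ⧸ M) := charZero_of_injective_algebraMap (algebraMap ℂ (R ⧸ M)).injective
    have f0 : ∀ r : R, (∀ p ∈ {J : Ideal R | ⊥ ≤ J ∧ J.IsMaximal}, r ∈ p) →
      Ideal.Quotient.mk M r = 0 := fun r hr => Ideal.Quotient.eq_zero_iff_mem.mpr (hr M ⟨hM0, hM⟩)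
    rw [← Ideal.Quotient.eq_zero_iff_mem]
    have := field_case (Ideal.Quotient.mk M a) (Ideal.Quotient.mk M b) (Ideal.Quotient.mk M x)
      (Ideal.Quotient.mk M y) (Ideal.Quotient.mk M z) (Ideal.Quotient.mk M w)
      (by simpa using congrArg (Ideal.Quotient.mk M) hy) (by simpa using f0 _ ha)
      (by simpa using congrArg (Ideal.Quotient.mk M) hz) (by simpa using f0 _ hb)
      (by simpa using congrArg (Ideal.Quotient.mk M) hx) (by simpa using f0 _ hx2)
      (by simpa using congrArg (Ideal.Quotient.mk M) hw) (by simpa using f0 _ hw2)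
    rw [he]
    simpa using this
  have hu : IsUnit ((a + b) ^ 2 + 1 - e) := by
    have := Ideal.mem_jacobson_bot.mp hj 1
    convert this using 1; ring
  obtain ⟨k, hk⟩ := hu.exists_right_inv
  have hsv : (a + b) * ((a + b) * e * k) = e := by
    linear_combination e * hk + k * hee
  refine ⟨(a + b) * e * k, ?_, ?_⟩
  · calc (a + b) * e * k = (a + b) * k * (e * e) := by rw [hee]; ring
      _ = (a + b) * e * k * e := by ring
      _ = (a + b) * e * k * ((a + b) * ((a + b) * e * k)) := by rw [hsv]
      _ = _ := by ring
  · rwa [hsv]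

theorem stmt15 {A : Type*} [NormedRing A] [NormedAlgebra ℂ A] [CompleteSpace A] (a b x : A)
    (ha : ∃ y, IsGenHiranoInv a y) (hb : ∃ y, IsGenHiranoInv b y)
    (hcomm : a * b = b * a) (hx : IsGDrazinInv a x)
    (h : ∃ y, IsGenHiranoInv (1 + x * b) y) :
    ∃ y, IsGenHiranoInv (a + b) y := by
  obtain ⟨y, hy⟩ := ha
  obtain ⟨z, hz⟩ := hb
  obtain ⟨w, hw⟩ := h
  have xa : x * a = a * x := hx.comm a rfl
  have xb : x * b = b * x := hx.comm b hcomm.symm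
  have ya : y * a = a * y := hy.comm a rfl
  have yb : y * b = b * y := hy.comm b hcomm.symm
  have yx : y * x = x * y := hy.comm x xa
  have za : z * a = a * z := hz.comm a hcomm
  have zb : z * b = b * z := hz.comm b rfl
  have zx : z * x = x * z := hz.comm x xb
  have zy : z * y = y * z := hz.comm y yb
  have hwc : ∀ c, c * x = x * c → c * b = b * c → w * c = c * w := by
    intro c h1 h2
    apply hw.comm
    have : Commute c (1 + x * b) :=
      (Commute.one_right c).add_right (Commute.mul_right h1 h2)
    exact this
  have wa := hwc a xa.symm hcomm
  have wb := hwc b xb.symm rfl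
  have wx := hwc x rfl xb
  have wy := hwc y yx yb
  have wz := hwc z zx zb
  obtain ⟨R, hSR, hRc, hRi⟩ := exists_comm_subalgebra ({a, b, x, y, z, w} : Set A) (by
    intro u hu v hv
    simp only [Set.mem_insert_iff, Set.mem_singleton_iff] at hu hv
    rcases hu with rfl | rfl | rfl | rfl | rfl | rfl <;>
    rcases hv with rfl | rfl | rfl | rfl | rfl | rfl <;>
    first | rfl | assumption | (symm; assumption))
  letI : CommRing R := { (inferInstance : Ring R) with
    mul_comm := fun u v => Subtype.ext (hRc u u.2 v v.2) }
  have hunit : ∀ r : R, IsUnit (r : A) → IsUnit r := by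
    intro r hr
    obtain ⟨v, h1, h2⟩ := isUnit_iff_exists.mp hr
    exact isUnit_iff_exists.mpr ⟨⟨v, hRi r r.2 v h1 h2⟩, Subtype.ext h1, Subtype.ext h2⟩
  have hjac : ∀ r : R, Quasinilpotent (r : A) → r ∈ Ideal.jacobson (⊥ : Ideal R) := by
    intro r hr
    rw [Ideal.mem_jacobson_bot]
    intro k
    apply hunit
    have := hr k (hRc _ k.2 _ r.2)
    rw [add_comm] at this
    exact this
  obtain ⟨v, hv1, hv2⟩ := comm_case (R := R) ⟨a, hSR (by simp)⟩ ⟨b, hSR (by simp)⟩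
    ⟨x, hSR (by simp)⟩ ⟨y, hSR (by simp)⟩ ⟨z, hSR (by simp)⟩ ⟨w, hSR (by simp)⟩
    (Subtype.ext hy.1) (hjac _ hy.2.2) (Subtype.ext hz.1) (hjac _ hz.2.2)
    (Subtype.ext hx.1) (hjac _ hx.2.2) (Subtype.ext hw.1) (hjac _ hw.2.2)
  refine ⟨v, congrArg Subtype.val hv1, hRc _ (R.add_mem (hSR (by simp)) (hSR (by simp))) _ v.2, ?_⟩
  apply quasinilpotent_of_units
  intro l
  have h1 := (Ideal.mem_jacobson_bot.mp hv2 (algebraMap ℂ R l)).map R.val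
  convert h1 using 1
  rw [add_comm, Algebra.smul_def, Algebra.commutes]
  rfl
end

section
/- Let A be a complex Banach algebra with identity, let a, b ∈ A each have a generalized Hirano inverse, and let x ∈ A be a g-Drazin inverse of a. If a²b = aba and b²a = bab, then a + b has a generalized Hirano inverse if and only if 1 + xb has a generalized Hirano inverse. -/
/-- Growth form of quasinilpotency. -/
def QN {A : Type*} [NormedRing A] (z : A) : Prop :=
  ∀ ε : ℝ, 0 < ε → ∃ C : ℝ, ∀ n : ℕ, ‖z ^ n‖ ≤ C * ε ^ n

section QNlemmas

variable {A : Type*} [NormedRing A]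

theorem norm_pow_le_aux (v : A) (n : ℕ) : ‖v ^ n‖ ≤ (‖(1 : A)‖ + 1) * (‖v‖ + 1) ^ n := by
  induction n with
  | zero => simp
  | succ k ih =>
    rw [pow_succ, pow_succ, ← mul_assoc]
    refine (norm_mul_le _ _).trans ?_
    gcongr
    linarith

theorem QN.of_pow_mul {u v t : A} (hu : QN u) (h : ∀ n, t ^ n = u ^ n * v ^ n) : QN t := by
  intro ε hε
  have hv : 0 < ‖v‖ + 1 := by positivity
  obtain ⟨C, hC⟩ := hu (ε / (‖v‖ + 1)) (by positivity)
  refine ⟨C * (‖(1 : A)‖ + 1), fun n => ?_⟩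
  rw [h]
  have h1 := hC n
  have h2 := norm_pow_le_aux v n
  calc ‖u ^ n * v ^ n‖ ≤ ‖u ^ n‖ * ‖v ^ n‖ := norm_mul_le _ _
    _ ≤ (C * (ε / (‖v‖ + 1)) ^ n) * ((‖(1 : A)‖ + 1) * (‖v‖ + 1) ^ n) :=
        mul_le_mul h1 h2 (norm_nonneg _) ((norm_nonneg _).trans h1)
    _ = C * (‖(1 : A)‖ + 1) * ε ^ n := by
        rw [div_pow]; field_simp

theorem QN.of_pow_mul' {u v t : A} (hu : QN u) (h : ∀ n, t ^ n = v ^ n * u ^ n) : QN t := by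
  intro ε hε
  have hv : 0 < ‖v‖ + 1 := by positivity
  obtain ⟨C, hC⟩ := hu (ε / (‖v‖ + 1)) (by positivity)
  refine ⟨C * (‖(1 : A)‖ + 1), fun n => ?_⟩
  rw [h]
  have h1 := hC n
  have h2 := norm_pow_le_aux v n
  calc ‖v ^ n * u ^ n‖ ≤ ‖u ^ n‖ * ‖v ^ n‖ := (norm_mul_le _ _).trans (mul_comm _ _).le
    _ ≤ (C * (ε / (‖v‖ + 1)) ^ n) * ((‖(1 : A)‖ + 1) * (‖v‖ + 1) ^ n) :=
        mul_le_mul h1 h2 (norm_nonneg _) ((norm_nonneg _).trans h1)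
    _ = C * (‖(1 : A)‖ + 1) * ε ^ n := by
        rw [div_pow]; field_simp

theorem QN.mul_comm_right {u v : A} (hu : QN u) (h : Commute u v) : QN (u * v) :=
  hu.of_pow_mul fun n => h.mul_pow n

theorem QN.neg {u : A} (hu : QN u) : QN (-u) := by
  intro ε hε
  obtain ⟨C, hC⟩ := hu ε hε
  refine ⟨C, fun n => ?_⟩
  rcases Nat.even_or_odd n with h | h
  · rw [h.neg_pow]; exact hC n
  · rw [h.neg_pow, norm_neg]; exact hC n

theorem QN.of_sq {u : A} (hu : QN (u ^ 2)) : QN u := by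
  intro ε hε
  obtain ⟨C, hC⟩ := hu (ε ^ 2) (by positivity)
  have hC0 : 0 ≤ C := by
    have := hC 0
    simp only [pow_zero, mul_one] at this
    exact (norm_nonneg _).trans this
  refine ⟨C + C * ‖u‖ / ε, fun n => ?_⟩
  rcases Nat.even_or_odd' n with ⟨k, rfl | rfl⟩
  · have := hC k
    rw [← pow_mul, ← pow_mul] at this
    refine this.trans ?_
    gcongr
    have : 0 ≤ C * ‖u‖ / ε := by positivity
    linarith
  · have := hC k
    rw [← pow_mul, ← pow_mul] at this
    rw [pow_succ]
    calc ‖u ^ (2 * k) * u‖ ≤ ‖u ^ (2 * k)‖ * ‖u‖ := norm_mul_le _ _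
      _ ≤ (C * ε ^ (2 * k)) * ‖u‖ := by gcongr
      _ = (C * ‖u‖ / ε) * ε ^ (2 * k + 1) := by rw [pow_succ]; field_simp
      _ ≤ _ := by gcongr; linarith

theorem QN.zero : QN (0 : A) := by
  intro ε hε
  refine ⟨‖(1 : A)‖, fun n => ?_⟩
  rcases n with _ | n
  · simp
  · simp; positivity

theorem QN.isUnit_one_sub [CompleteSpace A] {u : A} (hu : QN u) : IsUnit (1 - u) := by
  obtain ⟨C, hC⟩ := hu (1 / 2) (by norm_num)
  have hC0 : 0 ≤ C := by
    have := hC 0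
    simp only [pow_zero, mul_one] at this
    exact (norm_nonneg _).trans this
  obtain ⟨n, hn⟩ := exists_pow_lt_of_lt_one (show (0 : ℝ) < 1 / (C + 1) by positivity)
    (show (1 / 2 : ℝ) < 1 by norm_num)
  have h1 : ‖u ^ n‖ < 1 := by
    refine (hC n).trans_lt ?_
    calc C * (1 / 2) ^ n ≤ C * (1 / (C + 1)) := by gcongr
      _ < 1 := by rw [mul_one_div, div_lt_one (by positivity)]; linarith
  have h2 := isUnit_one_sub_of_norm_lt_one h1
  rw [← mul_neg_geom_sum] at h2
  refine ((Commute.isUnit_mul_iff ?_).1 h2).1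
  apply Commute.sum_right
  intro i _
  exact (Commute.one_left _).sub_left ((Commute.refl u).pow_right i)

end QNlemmas

theorem qn_iff {A : Type*} [NormedRing A] [NormedAlgebra ℂ A] [CompleteSpace A] (z : A) :
    Quasinilpotent z ↔ QN z := by
  constructor
  · intro h
    have hr : spectralRadius ℂ z = 0 := by
      rw [spectralRadius]
      refine le_antisymm (iSup₂_le fun k hk => ?_) bot_le
      by_cases hk0 : k = 0
      · simp [hk0]
      · exfalso
        rw [spectrum.mem_iff] at hk
        apply hk
        have h1 := h (algebraMap ℂ A (-k⁻¹)) (Algebra.commutes _ _)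
        have h2 : IsUnit (algebraMap ℂ A k) := (IsUnit.mk0 k hk0).map _
        have h3 := h2.mul h1
        convert h3 using 1
        rw [mul_add, mul_one, ← Algebra.commutes, ← mul_assoc, ← map_mul, mul_neg,
          mul_inv_cancel₀ hk0, map_neg, map_one]
        noncomm_ring
    intro ε hε
    have ht := spectrum.pow_norm_pow_one_div_tendsto_nhds_spectralRadius z
    rw [hr] at ht
    have hev := ht.eventually (gt_mem_nhds (show (0 : ENNReal) < ENNReal.ofReal ε by simpa using hε))
    obtain ⟨N, hN⟩ := Filter.eventually_atTop.1 hev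
    have hsum : 0 ≤ ∑ i ∈ Finset.range (N + 1), ‖z ^ i‖ / ε ^ i :=
      Finset.sum_nonneg fun i _ => by positivity
    refine ⟨1 + ∑ i ∈ Finset.range (N + 1), ‖z ^ i‖ / ε ^ i, fun n => ?_⟩
    by_cases hn : n < N + 1
    · have h1 : ‖z ^ n‖ / ε ^ n ≤ ∑ i ∈ Finset.range (N + 1), ‖z ^ i‖ / ε ^ i :=
        Finset.single_le_sum (f := fun i => ‖z ^ i‖ / ε ^ i)
          (fun i _ => by positivity) (Finset.mem_range.2 hn)
      rw [← div_le_iff₀ (by positivity)]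
      linarith
    · have h1 := hN n (by omega)
      have hn0 : n ≠ 0 := by omega
      rw [ENNReal.ofReal_lt_ofReal_iff hε, one_div] at h1
      have h2 : ‖z ^ n‖ ≤ ε ^ n := by
        have := pow_le_pow_left₀ (by positivity) h1.le n
        rwa [Real.rpow_inv_natCast_pow (norm_nonneg _) hn0] at this
      refine h2.trans ?_
      nlinarith [pow_pos hε n]
  · intro h x hx
    have h1 : QN (z * x) := h.mul_comm_right hx.symm
    have := h1.neg.isUnit_one_sub
    rwa [sub_neg_eq_add] at this

theorem comm_hirano {R : Type*} [CommRing R] (z C w v : R)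
    (hC : C = 1 + (z ^ 2 - z ^ 4) * C ^ 2) (hw : w * (1 - 2 * (z ^ 2 - z ^ 4) * C) = 1)
    (hv : (1 + (z ^ 2 - z ^ 4) * ((1 - 2 * z ^ 2) * w * C)) * v = 1) :
    ∃ y, y = y * z * y ∧ z ^ 2 - z * y = (z ^ 2 - z ^ 4) * ((1 - 2 * z ^ 2) * w * C) := by
  obtain ⟨n, hn⟩ : ∃ n, n = z ^ 2 - z ^ 4 := ⟨_, rfl⟩
  rw [← hn] at hC hw hv ⊢
  obtain ⟨q, hq⟩ : ∃ q, q = n * ((1 - 2 * z ^ 2) * w * C) := ⟨_, rfl⟩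
  rw [← hq] at hv ⊢
  have hw2 : w ^ 2 * (1 - 4 * n) = 1 := by
    linear_combination (w * (1 - 2 * n * C) + 1) * hw + 4 * w ^ 2 * n * hC
  have ht : w * n * C + (w * n * C) ^ 2 = w ^ 2 * n := by
    linear_combination w ^ 2 * n * hC - w * n * C * hw
  have h14 : (1 - 2 * z ^ 2) ^ 2 = 1 - 4 * n := by rw [hn]; ring
  have hp : (z ^ 2 - q) ^ 2 = z ^ 2 - q := by
    have hq' : q = (1 - 2 * z ^ 2) * (w * n * C) := by rw [hq]; ring
    linear_combination (q + z^2 * 0 + (1 - 2 * z ^ 2) * (w * n * C) + 1 - 2 * z ^ 2) * hq'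
      + (w * n * C + (w * n * C) ^ 2) * h14 + (1 - 4 * n) * ht + n * hw2 + hn
  have hzy : z * (z * (z ^ 2 - q) * v) = z ^ 2 - q := by
    linear_combination v * hp + (z ^ 2 - q) * hv
  refine ⟨z * (z ^ 2 - q) * v, ?_, ?_⟩
  · linear_combination (-z * (z ^ 2 - q) * v) * hzy - z * v * hp
  · rw [hzy]; ring

theorem exists_series {A : Type*} [NormedRing A] [NormedAlgebra ℂ A] [CompleteSpace A] (n : A)
    (hn : QN n) (c : ℕ → ℕ) (h0 : c 0 = 1) (h4 : ∀ k, c k ≤ 4 ^ k)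
    (hsucc : ∀ k, c (k + 1) = ∑ ij ∈ Finset.HasAntidiagonal.antidiagonal k, c ij.1 * c ij.2) : ∃ C, C = 1 + n * C ^ 2 ∧ ∀ g, Commute g n → Commute g C := by
  have hs : Summable fun k => ‖(c k : A) * n ^ k‖ := by
    obtain ⟨M, hM⟩ := hn (1 / 8) (by norm_num)
    have hg : Summable fun k : ℕ => M * (1 / 2 : ℝ) ^ k :=
      (summable_geometric_of_lt_one (by norm_num) (by norm_num)).mul_left M
    refine Summable.of_nonneg_of_le (fun _ => norm_nonneg _) (fun k => ?_) hg
    have h4' : (c k : ℝ) ≤ 4 ^ k := by exact_mod_cast h4 k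
    rw [← nsmul_eq_mul]
    calc ‖c k • n ^ k‖ ≤ c k * ‖n ^ k‖ := norm_nsmul_le
      _ ≤ 4 ^ k * (M * (1 / 8) ^ k) := by
        have := hM k
        gcongr
      _ = M * (4 * (1 / 8)) ^ k := by rw [mul_pow]; ring
      _ = M * (1 / 2) ^ k := by norm_num
  obtain ⟨f, hf⟩ : ∃ f : ℕ → A, ∀ k, f k = (c k : A) * n ^ k := ⟨_, fun _ => rfl⟩
  simp only [← hf] at hs
  refine ⟨∑' k, f k, ?_, ?_⟩
  · have h1 := tsum_mul_tsum_eq_tsum_sum_antidiagonal_of_summable_norm hs hs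
    have hS : Summable f := hs.of_norm
    have hanti : Summable fun k => ∑ kl ∈ Finset.HasAntidiagonal.antidiagonal k,
        f kl.1 * f kl.2 :=
      summable_sum_mul_antidiagonal_of_summable_norm' hs hS hs hS
    have e0 : f 0 = 1 := by simp [hf, h0]
    have e1 : ∀ k, f (k + 1) =
        n * ∑ kl ∈ Finset.HasAntidiagonal.antidiagonal k, f kl.1 * f kl.2 := by
      intro k
      rw [hf, hsucc, Nat.cast_sum, Finset.sum_mul, Finset.mul_sum]
      refine Finset.sum_congr rfl fun ij hij => ?_
      rw [← Finset.HasAntidiagonal.mem_antidiagonal.1 hij, Nat.cast_mul, pow_succ', pow_add, hf, hf]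
      rw [mul_assoc, mul_assoc, ← nsmul_eq_mul, ← nsmul_eq_mul, ← nsmul_eq_mul]
      simp only [smul_mul_assoc, mul_smul_comm, ← nsmul_eq_mul]
    calc ∑' k, f k = f 0 + ∑' k, f (k + 1) := hS.tsum_eq_zero_add
      _ = 1 + n * (∑' k, f k) ^ 2 := by
        rw [e0, pow_two, h1, ← hanti.tsum_mul_left]
        simp only [e1]
  · intro g hg
    refine Commute.tsum_right _ fun i => ?_
    rw [hf]
    exact (Nat.cast_commute _ _).symm.mul_right (hg.pow_right i)

theorem exists_catalan {A : Type*} [NormedRing A] [NormedAlgebra ℂ A] [CompleteSpace A] (n : A)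
    (hn : QN n) : ∃ C, C = 1 + n * C ^ 2 ∧ ∀ g, Commute g n → Commute g C := by
  refine exists_series n hn catalan catalan_zero (fun k => ?_) catalan_succ'
  rw [catalan_eq_centralBinom_div]
  exact (Nat.div_le_self _ _).trans (Nat.centralBinom_le_four_pow k)

theorem exists_inv_comm {A : Type*} [Ring A] {u : A} (hu : IsUnit u) :
    ∃ w, w * u = 1 ∧ u * w = 1 ∧ ∀ g, Commute g u → Commute g w := by
  obtain ⟨u, rfl⟩ := hu
  exact ⟨↑u⁻¹, by simp, by simp, fun g hg => hg.units_inv_right⟩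

theorem hirano_of_qn {A : Type*} [NormedRing A] [NormedAlgebra ℂ A] [CompleteSpace A] (z : A)
    (hz : QN (z ^ 3 - z)) : ∃ y, IsGenHiranoInv z y := by
  have hn : QN (z ^ 2 - z ^ 4) := by
    have h1 : Commute (z ^ 3 - z) (-z) :=
      (((Commute.refl z).pow_left 3).sub_left (Commute.refl z)).neg_right
    have h2 := hz.mul_comm_right h1
    have h3 : (z ^ 3 - z) * -z = z ^ 2 - z ^ 4 := by noncomm_ring
    rwa [h3] at h2
  have hgn : ∀ g, Commute g z → Commute g (z ^ 2 - z ^ 4) := fun g hg =>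
    (hg.pow_right 2).sub_right (hg.pow_right 4)
  obtain ⟨C, hC, hCc⟩ := exists_catalan _ hn
  have hC' : ∀ g, Commute g z → Commute g C := fun g hg => hCc g (hgn g hg)
  have hzC : Commute z C := hC' z (Commute.refl z)
  have hnC : Commute (z ^ 2 - z ^ 4) C := (hgn C hzC.symm).symm
  have hu1 : IsUnit (1 - 2 * (z ^ 2 - z ^ 4) * C) := by
    have h1 := (hn.mul_comm_right (v := 2 * C)
      ((Nat.cast_commute 2 (z ^ 2 - z ^ 4)).symm.mul_right hnC)).isUnit_one_sub
    convert h1 using 2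
    noncomm_ring
  obtain ⟨w, hw, -, hwc⟩ := exists_inv_comm hu1
  have hw' : ∀ g, Commute g z → Commute g w := fun g hg => hwc g <|
    (Commute.one_right g).sub_right (((Nat.cast_commute 2 g).symm.mul_right (hgn g hg)).mul_right
      (hC' g hg))
  have hzw : Commute z w := hw' z (Commute.refl z)
  have h2z : ∀ g, Commute g z → Commute g ((1 - 2 * z ^ 2) * w * C) := fun g hg =>
    (((Commute.one_right g).sub_right ((Nat.cast_commute 2 g).symm.mul_right
      (hg.pow_right 2))).mul_right (hw' g hg)).mul_right (hC' g hg)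
  have hq : QN ((z ^ 2 - z ^ 4) * ((1 - 2 * z ^ 2) * w * C)) :=
    hn.mul_comm_right (hgn _ (h2z z (Commute.refl z)).symm).symm
  have hu2 : IsUnit (1 + (z ^ 2 - z ^ 4) * ((1 - 2 * z ^ 2) * w * C)) := by
    have := hq.neg.isUnit_one_sub
    rwa [sub_neg_eq_add] at this
  obtain ⟨v, -, hv, hvc⟩ := exists_inv_comm hu2
  have hv' : ∀ g, Commute g z → Commute g v := fun g hg => hvc g <|
    (Commute.one_right g).add_right ((hgn g hg).mul_right (h2z g hg))
  have hzv : Commute z v := hv' z (Commute.refl z)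
  have hcomm : ∀ p ∈ ({z, C, w, v} : Set A), ∀ q ∈ ({z, C, w, v} : Set A), p * q = q * p := by
    have key : ∀ p ∈ ({z, C, w, v} : Set A), Commute p z := by
      rintro p (rfl | rfl | rfl | rfl)
      exacts [Commute.refl _, hzC.symm, hzw.symm, hzv.symm]
    intro p hp q hq
    have hp' := key p hp
    rcases hq with rfl | rfl | rfl | rfl
    exacts [hp', hC' _ hp', hw' _ hp', hv' _ hp']
  letI := Subring.closureCommRingOfComm hcomm
  let S := Subring.closure ({z, C, w, v} : Set A)
  have mz : z ∈ S := Subring.subset_closure (by simp)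
  have mC : C ∈ S := Subring.subset_closure (by simp)
  have mw : w ∈ S := Subring.subset_closure (by simp)
  have mv : v ∈ S := Subring.subset_closure (by simp)
  obtain ⟨y, hy1, hy2⟩ := comm_hirano (R := S) ⟨z, mz⟩ ⟨C, mC⟩ ⟨w, mw⟩ ⟨v, mv⟩
    (Subtype.ext hC) (Subtype.ext hw) (Subtype.ext hv)
  refine ⟨y, congrArg Subtype.val hy1, congrArg Subtype.val (mul_comm (⟨z, mz⟩ : S) y), ?_⟩
  have hy3 : z ^ 2 - z * y = (z ^ 2 - z ^ 4) * ((1 - 2 * z ^ 2) * w * C) :=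
    congrArg Subtype.val hy2
  rw [qn_iff, hy3]
  exact hq

theorem qn_of_hirano {A : Type*} [NormedRing A] [NormedAlgebra ℂ A] [CompleteSpace A] (z : A)
    (hz : ∃ y, IsGenHiranoInv z y) : QN (z ^ 3 - z) := by
  obtain ⟨y, h1, h2, h3⟩ := hz
  rw [qn_iff] at h3
  have hp : (z * y) * (z * y) = z * y := by
    rw [mul_assoc, ← mul_assoc y, ← h1]
  have hzy : Commute z y := h2
  obtain ⟨q, hq⟩ : ∃ q, q = z ^ 2 - z * y := ⟨_, rfl⟩
  rw [← hq] at h3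
  have hcz : Commute z (z * y) := (Commute.refl z).mul_right hzy
  have hqz : Commute z q := hq ▸ ((Commute.refl z).pow_right 2).sub_right hcz
  have hqp : Commute (z * y) q := by
    rw [hq]
    exact (hcz.symm.pow_right 2).sub_right (Commute.refl _)
  have hz2 : z ^ 2 = z * y + q := by rw [hq]; abel
  obtain ⟨p, hpd⟩ : ∃ p, p = z * y := ⟨_, rfl⟩
  rw [← hpd] at hp hcz hqp hz2
  apply QN.of_sq
  have e : (z ^ 3 - z) ^ 2 = q * ((2 * p - 1 + q) * (z ^ 2 - 1)) := by
    have e1 : (z ^ 3 - z) ^ 2 = (z ^ 2 * z ^ 2 - z ^ 2) * (z ^ 2 - 1) := by noncomm_ring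
    have e2 : z ^ 2 * z ^ 2 - z ^ 2 = q * (2 * p - 1 + q) := by
      have e3 : (p + q) * (p + q) - (p + q) = (p * p - p) + (p * q - q * p) + q * (2 * p - 1 + q) := by
        noncomm_ring
      rw [hz2, e3, hp, hqp.eq]; simp
    rw [e1, e2, mul_assoc]
  rw [e]
  refine h3.mul_comm_right ?_
  refine Commute.mul_right ?_ ((hqz.symm.pow_right 2).sub_right (Commute.one_right _))
  exact (((Nat.cast_commute 2 q).symm.mul_right hqp.symm).sub_right (Commute.one_right _)).add_right
    (Commute.refl q)

theorem tendsto_aux (K : ℝ) (s : ℝ) (hs : ∀ n : ℕ, 1 ≤ n → s ≤ K * (1 / 2) ^ n) : s ≤ 0 := by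
  have h : Filter.Tendsto (fun n : ℕ => K * (1 / 2 : ℝ) ^ n) Filter.atTop (nhds (K * 0)) :=
    (tendsto_pow_atTop_nhds_zero_of_lt_one (by norm_num) (by norm_num)).const_mul K
  rw [mul_zero] at h
  exact ge_of_tendsto h (Filter.eventually_atTop.2 ⟨1, hs⟩)

theorem gdrazin_comm {A : Type*} [NormedRing A] [NormedAlgebra ℂ A] [CompleteSpace A] (a x g : A)
    (hx : IsGDrazinInv a x) (hg : Commute g a) : Commute g x := by
  obtain ⟨h1, h2, h3⟩ := hx
  rw [qn_iff] at h3
  have hax : Commute a x := h2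
  obtain ⟨q, hq⟩ : ∃ q, q = a - a ^ 2 * x := ⟨_, rfl⟩
  rw [← hq] at h3
  obtain ⟨e, he⟩ : ∃ e, e = a * x := ⟨_, rfl⟩
  have hee : e * e = e := by rw [he, mul_assoc, ← mul_assoc x, ← h1]
  have hae : Commute a e := he ▸ (Commute.refl a).mul_right hax
  have hq' : q = a * (1 - e) := by rw [hq, he]; noncomm_ring
  have hfe : (1 - e) * (1 - e) = 1 - e := by
    have : (1 - e) * (1 - e) = 1 - e - e + e * e := by noncomm_ring
    rw [this, hee]; abel
  have hae' : Commute a (1 - e) := (Commute.one_right a).sub_right hae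
  have hqn : ∀ n, 1 ≤ n → q ^ n = a ^ n * (1 - e) := by
    intro n hn
    have : IsIdempotentElem (1 - e) := hfe
    rw [hq', hae'.mul_pow, this.pow_eq (by omega)]
  have hen : ∀ n, 1 ≤ n → e = x ^ n * a ^ n := by
    intro n hn
    have : IsIdempotentElem e := hee
    rw [← hax.symm.mul_pow, ← h2, ← he, this.pow_eq (by omega)]
  have hx0 : 0 < ‖x‖ + 1 := by positivity
  obtain ⟨C, hC⟩ := h3 (1 / (2 * (‖x‖ + 1))) (by positivity)
  have bnd : ∀ n, ‖x ^ n‖ * ‖g‖ * ‖q ^ n‖ ≤ ((‖(1 : A)‖ + 1) * ‖g‖ * C) * (1 / 2) ^ n := by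
    intro n
    calc ‖x ^ n‖ * ‖g‖ * ‖q ^ n‖ ≤ ((‖(1 : A)‖ + 1) * (‖x‖ + 1) ^ n) * ‖g‖ *
          (C * (1 / (2 * (‖x‖ + 1))) ^ n) := by
          gcongr
          · exact norm_pow_le_aux x n
          · exact hC n
      _ = _ := by rw [div_pow, mul_pow, div_pow]; field_simp
  have k1 : e * g * (1 - e) = 0 := by
    refine norm_le_zero_iff.1 (tendsto_aux ((‖(1 : A)‖ + 1) * ‖g‖ * C) _ fun n hn => ?_)
    have : e * g * (1 - e) = x ^ n * g * q ^ n := by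
      rw [hqn n hn, mul_assoc (x ^ n), ← mul_assoc g, (hg.pow_right n).eq, ← mul_assoc, ← mul_assoc,
        ← hen n hn]
    rw [this]
    refine le_trans ?_ (bnd n)
    exact (norm_mul_le _ _).trans (mul_le_mul_of_nonneg_right (norm_mul_le _ _) (norm_nonneg _))
  have k2 : (1 - e) * g * e = 0 := by
    refine norm_le_zero_iff.1 (tendsto_aux ((‖(1 : A)‖ + 1) * ‖g‖ * C) _ fun n hn => ?_)
    have : (1 - e) * g * e = q ^ n * g * x ^ n := by
      have hen' : e = a ^ n * x ^ n := by rw [(hax.pow_pow n n).eq]; exact hen n hn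
      calc (1 - e) * g * e = (1 - e) * g * (a ^ n * x ^ n) := by rw [← hen']
        _ = (1 - e) * (g * a ^ n) * x ^ n := by simp only [mul_assoc]
        _ = (1 - e) * (a ^ n * g) * x ^ n := by rw [(hg.pow_right n).eq]
        _ = (1 - e) * a ^ n * g * x ^ n := by simp only [mul_assoc]
        _ = q ^ n * g * x ^ n := by rw [hqn n hn, (hae'.pow_left n).eq]
    rw [this]
    refine le_trans ?_ (bnd n)
    calc ‖q ^ n * g * x ^ n‖ ≤ ‖q ^ n‖ * ‖g‖ * ‖x ^ n‖ :=
          (norm_mul_le _ _).trans (mul_le_mul_of_nonneg_right (norm_mul_le _ _) (norm_nonneg _))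
      _ = _ := by ring
  have k3 : e * g = g * e := by
    have e1 : e * g * (1 - e) = e * g - e * g * e := by noncomm_ring
    have e2 : (1 - e) * g * e = g * e - e * g * e := by noncomm_ring
    rw [e1, sub_eq_zero] at k1
    rw [e2, sub_eq_zero] at k2
    rw [k1, k2]
  have xe : x * e = x := by rw [he, ← mul_assoc, ← h1]
  have ex : e * x = x := by rw [he, h2, ← h1]
  change g * x = x * g
  symm
  calc x * g = x * e * g := by rw [xe]
    _ = x * (g * e) := by rw [mul_assoc, k3]
    _ = x * (g * a) * x := by rw [he]; simp only [mul_assoc]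
    _ = (x * a) * g * x := by rw [hg.eq]; simp only [mul_assoc]
    _ = g * (e * x) := by rw [← h2, ← he, k3, mul_assoc]
    _ = g * x := by rw [ex]

section main

variable {A : Type*} [NormedRing A]

theorem pow_mem_aux (S : NonUnitalSubring A) {u w : A} (hu : u ∈ S) (hw : w ∈ S) (n : ℕ) :
    w * u ^ n ∈ S := by
  induction n with
  | zero => simpa
  | succ k ih => rw [pow_succ, ← mul_assoc]; exact S.mul_mem ih hu

theorem pow_swap_aux (S : NonUnitalSubring A)
    (hS : ∀ w ∈ S, ∀ u ∈ S, ∀ v ∈ S, w * u * v = w * v * u) {u v w : A}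
    (hu : u ∈ S) (hv : v ∈ S) (hw : w ∈ S) (n : ℕ) : w * u ^ n * v = w * v * u ^ n := by
  induction n with
  | zero => simp
  | succ k ih =>
    rw [pow_succ, ← mul_assoc, hS _ (pow_mem_aux S hu hw k) _ hu _ hv, ih]
    simp only [mul_assoc]

theorem mul_pow_aux (S : NonUnitalSubring A)
    (hS : ∀ w ∈ S, ∀ u ∈ S, ∀ v ∈ S, w * u * v = w * v * u) {u v : A}
    (hu : u ∈ S) (hv : v ∈ S) (n : ℕ) : (u * v) ^ n = u ^ n * v ^ n := by
  induction n with
  | zero => simp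
  | succ k ih =>
    rw [pow_succ', ih, ← mul_assoc, mul_assoc u v]
    have h : u * (v * u ^ k) = u * u ^ k * v := by
      rw [← mul_assoc, pow_swap_aux S hS hu hv hu]
    rw [h, pow_succ' u, pow_succ' v, mul_assoc]

theorem qn_add (S : NonUnitalSubring A)
    (hS : ∀ w ∈ S, ∀ u ∈ S, ∀ v ∈ S, w * u * v = w * v * u) {u v : A}
    (hu : u ∈ S) (hv : v ∈ S) (qu : QN u) (qv : QN v) : QN (u + v) := by
  intro ε hε
  obtain ⟨C, hC⟩ := qu (ε / 2) (by positivity)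
  obtain ⟨D, hD⟩ := qv (ε / 2) (by positivity)
  have hC0 : 0 ≤ C := by
    have := hC 0
    simp only [pow_zero, mul_one] at this
    exact (norm_nonneg _).trans this
  have hD0 : 0 ≤ D := by
    have := hD 0
    simp only [pow_zero, mul_one] at this
    exact (norm_nonneg _).trans this
  have hw : u + v ∈ S := S.add_mem hu hv
  have key : ∀ n i j : ℕ, ‖(u + v) * u ^ i * v ^ j * (u + v) ^ n‖ ≤
      ‖u + v‖ * C * D * (ε / 2) ^ (i + j) * ε ^ n := by
    intro n
    induction n with
    | zero =>
      intro i j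
      rw [pow_zero, mul_one, pow_zero, mul_one]
      calc ‖(u + v) * u ^ i * v ^ j‖ ≤ ‖u + v‖ * ‖u ^ i‖ * ‖v ^ j‖ :=
            (norm_mul_le _ _).trans (mul_le_mul_of_nonneg_right (norm_mul_le _ _) (norm_nonneg _))
        _ ≤ ‖u + v‖ * (C * (ε / 2) ^ i) * (D * (ε / 2) ^ j) := by
            have := hC i
            have := hD j
            gcongr
        _ = _ := by rw [pow_add]; ring
    | succ k ih =>
      intro i j
      have e : (u + v) * u ^ i * v ^ j * (u + v) ^ (k + 1) =
          (u + v) * u ^ (i + 1) * v ^ j * (u + v) ^ k +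
          (u + v) * u ^ i * v ^ (j + 1) * (u + v) ^ k := by
        rw [pow_succ' (u + v), ← mul_assoc, mul_add, add_mul,
          pow_swap_aux S hS hv hu (pow_mem_aux S hu hw i), mul_assoc _ (u ^ i) u, ← pow_succ,
          mul_assoc _ (v ^ j) v, ← pow_succ]
      rw [e]
      refine (norm_add_le _ _).trans ((add_le_add (ih (i + 1) j) (ih i (j + 1))).trans (le_of_eq ?_))
      ring
  refine ⟨‖(1 : A)‖ + ‖u + v‖ * C * D / ε, fun n => ?_⟩
  rcases n with _ | n
  · simp only [pow_zero, mul_one]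
    have : 0 ≤ ‖u + v‖ * C * D / ε := by positivity
    linarith
  · have := key n 0 0
    simp only [pow_zero, mul_one, add_zero] at this
    rw [pow_succ']
    refine this.trans ?_
    have e : ‖u + v‖ * C * D * ε ^ n = ‖u + v‖ * C * D / ε * ε ^ (n + 1) := by
      rw [pow_succ]; field_simp
    rw [e]
    gcongr
    linarith [norm_nonneg (1 : A)]

theorem closure_swap (Z : Set A) (hZ : ∀ w ∈ Z, ∀ u ∈ Z, ∀ v ∈ Z, w * u * v = w * v * u) :
    ∀ w ∈ NonUnitalSubring.closure Z, ∀ u ∈ NonUnitalSubring.closure Z,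
      ∀ v ∈ NonUnitalSubring.closure Z, w * u * v = w * v * u := by
  have s1 : ∀ w ∈ NonUnitalSubring.closure Z, ∀ u ∈ Z, ∀ v ∈ Z, w * u * v = w * v * u := by
    intro w hw u hu v hv
    induction hw using NonUnitalSubring.closure_induction with
    | mem w hw => exact hZ w hw u hu v hv
    | zero => simp
    | add p q _ _ hp hq => simp only [add_mul, hp, hq]
    | neg p _ hp => simp only [neg_mul, hp]
    | mul p q _ _ hp hq =>
      rw [mul_assoc p q u, mul_assoc p, hq, mul_assoc p q v, mul_assoc p]
  have s2 : ∀ v ∈ NonUnitalSubring.closure Z, ∀ w ∈ NonUnitalSubring.closure Z, ∀ u ∈ Z,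
      w * u * v = w * v * u := by
    intro v hv
    induction hv using NonUnitalSubring.closure_induction with
    | mem v hv => intro w hw u hu; exact s1 w hw u hu v hv
    | zero => simp
    | add p q _ _ hp hq =>
      intro w hw u hu
      simp only [add_mul, mul_add, hp w hw u hu, hq w hw u hu]
    | neg p _ hp =>
      intro w hw u hu
      simp only [neg_mul, mul_neg, hp w hw u hu]
    | mul p q mp mq hp hq =>
      intro w hw u hu
      rw [← mul_assoc, hp w hw u hu, hq _ (mul_mem hw mp) u hu, mul_assoc w p q]
  intro w hw u hu v hv
  induction hu using NonUnitalSubring.closure_induction generalizing w with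
  | mem u hu => exact s2 v hv w hw u hu
  | zero => simp
  | add p q _ _ hp hq => simp only [add_mul, mul_add, hp w hw, hq w hw]
  | neg p _ hp => simp only [neg_mul, mul_neg, hp w hw]
  | mul p q mp mq hp hq =>
    rw [← mul_assoc, hq _ (mul_mem hw mp), hp w hw, ← mul_assoc]

end main

theorem stmt16 {A : Type*} [NormedRing A] [NormedAlgebra ℂ A] [CompleteSpace A] (a b x : A)
    (ha : ∃ y, IsGenHiranoInv a y) (hb : ∃ y, IsGenHiranoInv b y)
    (hx : IsGDrazinInv a x)
    (h1 : a ^ 2 * b = a * b * a) (h2 : b ^ 2 * a = b * a * b) :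
    (∃ y, IsGenHiranoInv (a + b) y) ↔ (∃ y, IsGenHiranoInv (1 + x * b) y) := by
  have qa := qn_of_hirano a ha
  have qb := qn_of_hirano b hb
  have hab : Commute (a * b) a := by
    change a * b * a = a * (a * b)
    rw [← h1, pow_two, mul_assoc]
  have hxab := (gdrazin_comm a x (a * b) hx hab).eq
  obtain ⟨x1, x2, x3⟩ := hx
  rw [qn_iff] at x3
  have xxa : x * x * a = x := by rw [mul_assoc, ← x2, ← mul_assoc, ← x1]
  have axx : a * x * x = x := by rw [x2, ← x1]
  -- the generators
  have aab : a * a * b = a * b * a := by rw [← h1, pow_two]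
  have bba : b * b * a = b * a * b := by rw [← h2, pow_two]
  have axb : a * x * b = a * b * x := by rw [hxab, x2, mul_assoc]
  have xab : x * a * b = x * b * a := by
    have e : ∀ t, x * t = x * x * (a * t) := fun t => by rw [← mul_assoc, xxa]
    rw [mul_assoc, e, mul_assoc x b, e (b * a), ← mul_assoc a a, aab, mul_assoc a b a]
  have xxb : x * x * b = x * b * x := by
    have e : ∀ t, x * t = x * x * (a * t) := fun t => by rw [← mul_assoc, xxa]
    rw [mul_assoc, e, mul_assoc x b, e (b * x), ← mul_assoc a x, axb, mul_assoc a b x]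
  have bxb : b * x * b = b * b * x := by
    symm
    calc b * b * x = b * b * a * x * x := by rw [mul_assoc, mul_assoc, mul_assoc, ← mul_assoc a, axx]; simp only [mul_assoc]
      _ = b * (a * b * x) * x := by rw [bba]; simp only [mul_assoc]
      _ = b * (x * (a * b)) * x := by rw [hxab]
      _ = b * x * (a * b * x) := by simp only [mul_assoc]
      _ = b * (x * x * a) * b := by rw [hxab]; simp only [mul_assoc]
      _ = b * x * b := by rw [xxa]
  have tax : ∀ w : A, w * a * x = w * x * a := fun w => by rw [mul_assoc, x2, mul_assoc]
  have hZ : ∀ w ∈ ({a, b, x} : Set A), ∀ u ∈ ({a, b, x} : Set A), ∀ v ∈ ({a, b, x} : Set A),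
      w * u * v = w * v * u := by
    rintro w (rfl | rfl | rfl) u (rfl | rfl | rfl) v (rfl | rfl | rfl) <;>
    first
      | rfl
      | assumption
      | (symm; assumption)
      | exact tax _
      | exact (tax _).symm
  have hS := closure_swap _ hZ
  obtain ⟨S, hSd⟩ : ∃ S, S = NonUnitalSubring.closure ({a, b, x} : Set A) := ⟨_, rfl⟩
  have ma : a ∈ S := hSd ▸ NonUnitalSubring.subset_closure (by simp)
  have mb : b ∈ S := hSd ▸ NonUnitalSubring.subset_closure (by simp)
  have mx : x ∈ S := hSd ▸ NonUnitalSubring.subset_closure (by simp)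
  rw [← hSd] at hS
  clear hZ hSd
  -- the quasinilpotents of S
  let N : Set A := {z | z ∈ S ∧ QN z}
  have Nadd : ∀ {u v}, u ∈ N → v ∈ N → u + v ∈ N := fun hu hv =>
    ⟨S.add_mem hu.1 hv.1, qn_add S hS hu.1 hv.1 hu.2 hv.2⟩
  have Nneg : ∀ {u}, u ∈ N → -u ∈ N := fun hu => ⟨S.neg_mem hu.1, hu.2.neg⟩
  have Nr : ∀ {u v}, u ∈ N → v ∈ S → u * v ∈ N := fun hu hv =>
    ⟨S.mul_mem hu.1 hv, hu.2.of_pow_mul (mul_pow_aux S hS hu.1 hv)⟩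
  have Nl : ∀ {u v}, u ∈ N → v ∈ S → v * u ∈ N := fun hu hv =>
    ⟨S.mul_mem hv hu.1, hu.2.of_pow_mul' (mul_pow_aux S hS hv hu.1)⟩
  have Nc : ∀ {u v}, u ∈ S → v ∈ S → u * v - v * u ∈ N := fun {u v} hu hv => by
    have hm := S.sub_mem (S.mul_mem hu hv) (S.mul_mem hv hu)
    refine ⟨hm, QN.of_sq ?_⟩
    have : (u * v - v * u) ^ 2 = 0 := by
      rw [pow_two, mul_sub, ← mul_assoc, ← mul_assoc, hS _ hm _ hu _ hv, sub_self]
    rw [this]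
    exact QN.zero
  have m3 : ∀ {z}, z ∈ S → z ^ 3 ∈ S := fun {z} hz => by
    rw [pow_succ, pow_two]; exact S.mul_mem (S.mul_mem hz hz) hz
  have Na : a ^ 3 - a ∈ N := ⟨S.sub_mem (m3 ma) ma, qa⟩
  have Nb : b ^ 3 - b ∈ N := ⟨S.sub_mem (m3 mb) mb, qb⟩
  have Nx : a - a ^ 2 * x ∈ N := by
    refine ⟨S.sub_mem ma ?_, x3⟩
    rw [pow_two]; exact S.mul_mem (S.mul_mem ma ma) mx
  have Nxa : x - a ∈ N := by
    have t1 := Nneg (Nadd (Nr Na (S.mul_mem mx mx)) Nx)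
    have e : -((a ^ 3 - a) * (x * x) + (a - a ^ 2 * x)) = x - a := by
      have e1 : a ^ 3 * (x * x) = a ^ 2 * x := by
        have : a ^ 3 * (x * x) = a ^ 2 * (a * x * x) := by noncomm_ring
        rw [this, axx]
      have e2 : a * (x * x) = x := by rw [← mul_assoc, axx]
      rw [sub_mul, e1, e2]; abel
    rwa [e] at t1
  have mab := S.mul_mem ma mb
  have mxb := S.mul_mem mx mb
  have Nxb : x * b - a * b ∈ N := by rw [← sub_mul]; exact Nr Nxa mb
  obtain ⟨P, hP⟩ : ∃ P, P = 3 * (a * a * b + a * b * b) := ⟨_, rfl⟩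
  obtain ⟨P', hP'⟩ : ∃ P', P' = 3 * (a * b + a * b * (a * b)) := ⟨_, rfl⟩
  -- reduction of the sum
  have R1 : ((a + b) ^ 3 - (a + b)) - P ∈ N := by
    have Nba := Nc mb ma
    have t := Nadd (Nadd (Nadd Na Nb) (Nr Nba ma)) (Nadd (Nr Nba mb) (Nr Nba mb))
    convert t using 1
    have e : ((a + b) ^ 3 - (a + b)) - 3 * (a * a * b + a * b * b) =
        (a ^ 3 - a + (b ^ 3 - b) + (b * a - a * b) * a + ((b * a - a * b) * b + (b * a - a * b) * b))
        - 2 * (a * a * b - a * b * a) + (b * b * a - b * a * b) := by noncomm_ring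
    rw [hP, e, aab, bba]; simp
  have R2 : ((1 + x * b) ^ 3 - (1 + x * b)) - P' ∈ N := by
    obtain ⟨c, hc⟩ : ∃ c, c = x * b := ⟨_, rfl⟩
    obtain ⟨d, hd⟩ : ∃ d, d = a * b := ⟨_, rfl⟩
    rw [← hc] at mxb Nxb ⊢
    rw [← hd] at mab Nxb hP'
    have Nd : d ^ 3 - d ∈ N := by
      rw [hd, mul_pow_aux S hS ma mb]
      have t := Nadd (Nr Na (m3 mb)) (Nl Nb ma)
      convert t using 1
      noncomm_ring
    have N2 : c * c - d * d ∈ N := by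
      have t := Nadd (Nr Nxb mxb) (Nl Nxb mab)
      convert t using 1
      noncomm_ring
    have N3 : c ^ 3 - d ^ 3 ∈ N := by
      have t := Nadd (Nr N2 mxb) (Nl Nxb (S.mul_mem mab mab))
      convert t using 1
      noncomm_ring
    have t := Nadd (Nadd (Nadd N3 Nd) (Nadd Nxb Nxb)) (Nadd N2 (Nadd N2 N2))
    convert t using 1
    rw [hP']
    noncomm_ring
  have mP : P ∈ S := by
    rw [hP, ← Nat.cast_ofNat, ← nsmul_eq_mul]
    exact nsmul_mem (S.add_mem (S.mul_mem (S.mul_mem ma ma) mb) (S.mul_mem mab mb)) _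
  have mP' : P' ∈ S := by
    rw [hP', ← Nat.cast_ofNat, ← nsmul_eq_mul]
    exact nsmul_mem (S.add_mem mab (S.mul_mem mab mab)) _
  have abab : a * b * (a * b) = a * a * b * b := by
    rw [← mul_assoc, ← aab]
  have R3 : P - a * P' ∈ N := by
    have t := Nneg (Nr Na (S.mul_mem mb mb))
    have t := Nadd t (Nadd t t)
    convert t using 1
    rw [hP, hP', abab]
    noncomm_ring
  have R4 : P' - a * P ∈ N := by
    have t := Nneg (Nr Na mb)
    have t := Nadd t (Nadd t t)
    convert t using 1
    rw [hP, hP', abab]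
    noncomm_ring
  have sub_add_mem : ∀ {u v}, u - v ∈ N → v ∈ N → u ∈ N := fun {u v} h h' => by
    have := Nadd h h'
    rwa [sub_add_cancel] at this
  have sub_add_mem' : ∀ {u v}, u - v ∈ N → u ∈ N → v ∈ N := fun {u v} h h' => by
    have := Nadd (Nneg h) h'
    rwa [neg_sub, sub_add_cancel] at this
  have mem1 : (a + b) ^ 3 - (a + b) ∈ S := S.sub_mem (m3 (S.add_mem ma mb)) (S.add_mem ma mb)
  have mem2 : (1 + x * b) ^ 3 - (1 + x * b) ∈ S := by
    have := S.add_mem R2.1 mP'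
    rwa [sub_add_cancel] at this
  constructor
  · intro h
    have n1 : (a + b) ^ 3 - (a + b) ∈ N := ⟨mem1, qn_of_hirano _ h⟩
    have n2 : P ∈ N := sub_add_mem' R1 n1
    have n3 : P' ∈ N := sub_add_mem R4 (Nl n2 ma)
    exact hirano_of_qn _ (sub_add_mem R2 n3).2
  · intro h
    have n1 : (1 + x * b) ^ 3 - (1 + x * b) ∈ N := ⟨mem2, qn_of_hirano _ h⟩
    have n2 : P' ∈ N := sub_add_mem' R2 n1
    have n3 : P ∈ N := sub_add_mem R3 (Nl n2 ma)
    exact hirano_of_qn _ (sub_add_mem R1 n3).2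
end

section
/- Let A be a complex Banach algebra with identity and let a, b ∈ A each have a generalized Hirano inverse. If ab = 0, then a + b has a generalized Hirano inverse. -/
/-- All weighted power sums converge. -/
def SuperDecay {A : Type*} [NormedRing A] (a : A) : Prop :=
  ∀ M : ℝ, 0 ≤ M → Summable (fun n : ℕ => M ^ n * ‖a ^ n‖)

theorem pow_bound {A : Type*} [NormedRing A] (w : A) (n : ℕ) :
    ‖w ^ n‖ ≤ (1 + ‖(1 : A)‖) * ‖w‖ ^ n := by
  rcases Nat.eq_zero_or_pos n with rfl | hn
  · simp
  · have h1 := norm_pow_le' w hn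
    have h2 : 0 ≤ ‖(1 : A)‖ * ‖w‖ ^ n := by positivity
    linarith

theorem SuperDecay.mul {A : Type*} [NormedRing A] {a w : A} (ha : SuperDecay a)
    (h : Commute a w) : SuperDecay (a * w) := by
  intro M hM
  refine Summable.of_nonneg_of_le (fun n => by positivity) (fun n => ?_)
    ((ha (M * ‖w‖) (by positivity)).mul_left (1 + ‖(1 : A)‖))
  rw [h.mul_pow]
  calc M ^ n * ‖a ^ n * w ^ n‖ ≤ M ^ n * (‖a ^ n‖ * ((1 + ‖(1 : A)‖) * ‖w‖ ^ n)) := by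
        gcongr
        exact (norm_mul_le _ _).trans (by gcongr; exact pow_bound w n)
    _ = _ := by rw [mul_pow]; ring

theorem SuperDecay.isUnit {A : Type*} [NormedRing A] [CompleteSpace A] {a : A}
    (ha : SuperDecay a) : IsUnit (1 - a) := by
  have hs : Summable (fun n : ℕ => a ^ n) := by
    have := ha 1 zero_le_one
    simp only [one_pow, one_mul] at this
    exact this.of_norm
  exact ⟨⟨1 - a, ∑' n, a ^ n, hs.one_sub_mul_tsum_pow, hs.tsum_pow_mul_one_sub⟩, rfl⟩

theorem SuperDecay.quasinilpotent {A : Type*} [NormedRing A] [CompleteSpace A] {a : A}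
    (ha : SuperDecay a) : Quasinilpotent a := by
  intro x hx
  have h : Commute a (-x) := Commute.neg_right hx.symm
  have := (ha.mul h).isUnit
  simpa using this

theorem superDecay_of_spectrum {A : Type*} [NormedRing A] [NormedAlgebra ℂ A] [CompleteSpace A]
    {a : A} (ha : ∀ z ∈ spectrum ℂ a, z = 0) : SuperDecay a := by
  intro M hM
  have hr : spectralRadius ℂ a = 0 := by
    simp only [spectralRadius, ENNReal.iSup_eq_zero]
    intro z hz
    simp [ha z hz]
  have ht := spectrum.pow_norm_pow_one_div_tendsto_nhds_spectralRadius a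
  rw [hr] at ht
  have hpos : 0 < (2 * (M + 1))⁻¹ := by positivity
  have hev := ht.eventually_lt_const (u := ENNReal.ofReal (2 * (M + 1))⁻¹)
    (ENNReal.ofReal_pos.mpr hpos)
  refine Summable.of_norm_bounded_eventually_nat (g := fun n : ℕ => (1 / 2 : ℝ) ^ n)
    (summable_geometric_of_lt_one (by norm_num) (by norm_num)) ?_
  filter_upwards [hev, Filter.eventually_gt_atTop 0] with n hn hn0
  have h1 : ‖a ^ n‖ ^ (1 / n : ℝ) < (2 * (M + 1))⁻¹ := (ENNReal.ofReal_lt_ofReal_iff hpos).mp hn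
  have h2 : ‖a ^ n‖ ≤ ((2 * (M + 1))⁻¹) ^ n := by
    have h3 := pow_le_pow_left₀ (by positivity) h1.le n
    rwa [one_div, Real.rpow_inv_natCast_pow (norm_nonneg _) hn0.ne'] at h3
  rw [Real.norm_of_nonneg (by positivity)]
  calc M ^ n * ‖a ^ n‖ ≤ (M + 1) ^ n * ((2 * (M + 1))⁻¹) ^ n := by gcongr; linarith
    _ = (1 / 2) ^ n := by
      rw [← mul_pow]
      congr 1
      field_simp

theorem catalan_le (n : ℕ) : catalan n ≤ 4 ^ n := by
  rw [catalan_eq_centralBinom_div]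
  refine (Nat.div_le_self _ _).trans ?_
  rw [Nat.centralBinom_eq_two_mul_choose, show 4 = 2 ^ 2 by rfl, ← pow_mul]
  exact Nat.choose_le_two_pow _ _

theorem SuperDecay.exists_catalan {A : Type*} [NormedRing A] [CompleteSpace A]
    {r : A} (hr : SuperDecay r) :
    ∃ s : A, s = 1 + r * (s * s) ∧ ∀ x, Commute x r → Commute x s := by
  have hn : Summable (fun n : ℕ => ‖(catalan n : A) * r ^ n‖) := by
    refine Summable.of_nonneg_of_le (fun n => norm_nonneg _) (fun n => ?_) (hr 4 (by norm_num))
    rw [← nsmul_eq_mul]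
    refine (norm_nsmul_le ..).trans ?_
    gcongr
    exact_mod_cast catalan_le n
  refine ⟨∑' n : ℕ, (catalan n : A) * r ^ n, ?_, ?_⟩
  · rw [tsum_mul_tsum_eq_tsum_sum_antidiagonal_of_summable_norm hn hn]
    rw [← Summable.tsum_mul_left]
    · rw [hn.of_norm.tsum_eq_zero_add]
      simp only [catalan_zero, Nat.cast_one, pow_zero, mul_one]
      congr 1
      refine tsum_congr fun n => ?_
      rw [catalan_succ', Nat.cast_sum, Finset.sum_mul, Finset.mul_sum]
      refine Finset.sum_congr rfl fun ij hij => ?_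
      rw [Finset.HasAntidiagonal.mem_antidiagonal] at hij
      rw [← hij, pow_succ', pow_add, Nat.cast_mul]
      simp only [← Nat.cast_mul, ← nsmul_eq_mul, smul_mul_assoc, mul_smul_comm, smul_smul,
        mul_assoc]
      try rw [mul_comm (catalan ij.1)]
    · exact (summable_norm_sum_mul_antidiagonal_of_summable_norm hn hn).of_norm
  · intro x hx
    exact Commute.tsum_right _ fun n => (Nat.commute_cast x _).mul_right (hx.pow_right n)

theorem comm_idem {R : Type*} [CommRing R] (c v s : R) (hv : (1 - 4 * (c ^ 2 - c ^ 4)) * v = 1)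
    (hs : s = 1 + -((c ^ 2 - c ^ 4) * v) * (s * s)) :
    (c ^ 2 + (2 * c ^ 2 - 1) * ((c ^ 2 - c ^ 4) * v * s)) ^ 2
      = c ^ 2 + (2 * c ^ 2 - 1) * ((c ^ 2 - c ^ 4) * v * s) := by
  have h1 : ((c ^ 2 - c ^ 4) * v * s) ^ 2 + (c ^ 2 - c ^ 4) * v * s = (c ^ 2 - c ^ 4) * v := by
    linear_combination ((c ^ 2 - c ^ 4) * v) * hs
  linear_combination (1 - 4 * (c ^ 2 - c ^ 4)) * h1 + (c ^ 2 - c ^ 4) * hv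

theorem exists_hirano {A : Type*} [NormedRing A] [NormedAlgebra ℂ A] [CompleteSpace A] (c : A)
    (hc : ∀ μ : ℂ, μ ≠ 0 → μ ^ 2 ≠ 1 → IsUnit (algebraMap ℂ A μ - c)) :
    ∃ x, IsGenHiranoInv c x := by
  have hq : SuperDecay (c ^ 2 - c ^ 4) := by
    apply superDecay_of_spectrum
    intro z hz
    have hd : 0 < (Polynomial.X ^ 2 - Polynomial.X ^ 4 : Polynomial ℂ).degree := by
      have : (Polynomial.X ^ 2 - Polynomial.X ^ 4 : Polynomial ℂ).degree = 4 := by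
        compute_degree!
      rw [this]; norm_num
    have hm := spectrum.map_polynomial_aeval_of_degree_pos c _ hd
    simp only [map_sub, map_pow, Polynomial.aeval_X] at hm
    rw [hm] at hz
    obtain ⟨μ, hμ, rfl⟩ := hz
    simp only [Polynomial.eval_sub, Polynomial.eval_pow, Polynomial.eval_X]
    by_contra hne
    refine hμ (hc μ ?_ ?_)
    · rintro rfl; simp at hne
    · intro h1
      apply hne
      linear_combination (-μ ^ 2) * h1
  let Z : Subring A := Subring.centralizer (Subring.centralizer {c} : Set A)
  have memZ : ∀ x : A, x ∈ Z ↔ ∀ y, Commute y c → Commute y x := by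
    intro x
    simp only [Z, Subring.mem_centralizer_iff, SetLike.mem_coe, Set.mem_singleton_iff, forall_eq]
    exact ⟨fun h y hy => h y hy.symm, fun h y hy => h y hy.symm⟩
  have hcomm : ∀ x ∈ Z, ∀ y ∈ Z, Commute x y := fun x hx y hy =>
    (memZ y).1 hy x ((memZ x).1 hx c (Commute.refl c)).symm
  letI : CommRing Z :=
    { (inferInstance : Ring Z) with mul_comm := fun x y => Subtype.ext (hcomm x x.2 y y.2) }
  have unitZ : ∀ x : Z, IsUnit (x : A) → IsUnit x := by
    rintro ⟨x, hx⟩ ⟨u, hu⟩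
    have hi : ((u⁻¹ : Aˣ) : A) ∈ Z := (memZ _).2 fun y hy => by
      have := (memZ x).1 hx y hy
      rw [← show (u : A) = x from hu] at this
      exact this.units_inv_right
    have hu' : (u : A) = x := hu
    refine IsUnit.of_mul_eq_one ⟨_, hi⟩ (Subtype.ext ?_)
    change x * ((u⁻¹ : Aˣ) : A) = 1
    rw [← hu']; simp
  have hcZ : c ∈ Z := (memZ c).2 fun y hy => hy
  let C : Z := ⟨c, hcZ⟩
  have hqw : ∀ w : Z, SuperDecay (((C ^ 2 - C ^ 4) * w : Z) : A) := fun w =>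
    hq.mul (hcomm _ (C ^ 2 - C ^ 4).2 _ w.2)
  have hu1 : IsUnit (1 - 4 * (C ^ 2 - C ^ 4)) := by
    apply unitZ
    have := (hqw 4).isUnit
    rw [mul_comm] at this
    exact this
  obtain ⟨V, hV⟩ := hu1.exists_right_inv
  have hr : SuperDecay ((-((C ^ 2 - C ^ 4) * V) : Z) : A) := by
    have := hqw (-V)
    rwa [mul_neg] at this
  obtain ⟨s, hs, hs'⟩ := hr.exists_catalan
  have hsZ : s ∈ Z := (memZ s).2 fun y hy => hs' y ((memZ _).1 (-((C ^ 2 - C ^ 4) * V)).2 y hy)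
  let S : Z := ⟨s, hsZ⟩
  have hS : S = 1 + -((C ^ 2 - C ^ 4) * V) * (S * S) := Subtype.ext hs
  have hF := comm_idem C V S hV hS
  obtain ⟨F, hFdef⟩ : ∃ F, F = C ^ 2 + (2 * C ^ 2 - 1) * ((C ^ 2 - C ^ 4) * V * S) := ⟨_, rfl⟩
  rw [← hFdef] at hF
  have hu2 : IsUnit (1 - (F - C ^ 2) * F) := by
    apply unitZ
    have := (hqw ((2 * C ^ 2 - 1) * V * S * F)).isUnit
    have e : (C ^ 2 - C ^ 4) * ((2 * C ^ 2 - 1) * V * S * F) = (F - C ^ 2) * F := by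
      linear_combination (-F) * hFdef
    rw [e] at this
    exact this
  obtain ⟨W, hW⟩ := hu2.exists_right_inv
  have hCB : C * (C * F * W) = F := by
    linear_combination F * hW + (C ^ 2 * W) * (-hF) + W * (1 + F) * hF
  refine ⟨((C * F * W : Z) : A), ?_, ?_, ?_⟩
  · have : C * F * W = (C * F * W) * C * (C * F * W) := by
      linear_combination (-(C * F * W)) * hCB - (C * W) * hF
    exact congrArg Subtype.val this
  · exact congrArg Subtype.val (mul_comm C (C * F * W))
  · have e : C ^ 2 - C * (C * F * W) = (C ^ 2 - C ^ 4) * (-((2 * C ^ 2 - 1) * V * S)) := by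
      rw [hCB]; linear_combination -hFdef
    have := (hqw (-((2 * C ^ 2 - 1) * V * S))).quasinilpotent
    rw [← e] at this
    exact this

theorem hirano_unit {A : Type*} [NormedRing A] [NormedAlgebra ℂ A] [CompleteSpace A] (a x : A)
    (h : IsGenHiranoInv a x) (μ : ℂ) (h0 : μ ≠ 0) (h1 : μ ^ 2 ≠ 1) :
    IsUnit (algebraMap ℂ A μ - a) := by
  obtain ⟨hx, hax, hq⟩ := h
  have h1' : μ ^ 2 - 1 ≠ 0 := sub_ne_zero.2 h1
  obtain ⟨p, hp⟩ : ∃ p, p = a * x := ⟨_, rfl⟩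
  have hpp : p * p = p := by
    rw [hp]
    calc a * x * (a * x) = a * (x * a * x) := by simp only [mul_assoc]
      _ = a * x := by rw [← hx]
  have hpa : Commute a p := by
    rw [hp]; exact (Commute.refl a).mul_right hax
  rw [← hp] at hq
  -- the inverse of `μ ^ 2 - p`
  obtain ⟨v, hv⟩ : ∃ v : A, v = (μ ^ 2)⁻¹ • (1 - p) + (μ ^ 2 - 1)⁻¹ • p := ⟨_, rfl⟩
  have hvp : ∀ y, Commute y p → Commute y v := by
    intro y hy
    rw [hv]
    exact (((Commute.one_right y).sub_right hy).smul_right _).add_right (hy.smul_right _)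
  have hvm : (algebraMap ℂ A (μ ^ 2) - p) * v = 1 := by
    have e1 : p * (1 - p) = 0 := by rw [mul_sub, hpp, mul_one, sub_self]
    rw [hv, sub_mul, ← Algebra.smul_def, mul_add, mul_smul_comm, mul_smul_comm, e1, hpp, smul_add,
      smul_smul, smul_smul, mul_inv_cancel₀ (pow_ne_zero 2 h0), smul_zero, zero_add, one_smul,
      add_sub_assoc, ← sub_smul]
    have : μ ^ 2 * (μ ^ 2 - 1)⁻¹ - (μ ^ 2 - 1)⁻¹ = 1 := by field_simp
    rw [this, one_smul, sub_add_cancel]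
  have hvm' : v * (algebraMap ℂ A (μ ^ 2) - p) = 1 := by
    rw [← hvm]
    have h3 : Commute v (algebraMap ℂ A (μ ^ 2)) := (Algebra.commutes (μ ^ 2) v).symm
    exact (h3.sub_right (hvp p (Commute.refl p)).symm).eq
  have hqp : Commute (a ^ 2 - p) p := (hpa.pow_left 2).sub_left (Commute.refl p)
  have hu := hq (-v) ((hvp _ hqp).neg_right.symm)
  have hprod : IsUnit ((algebraMap ℂ A μ - a) * (algebraMap ℂ A μ + a)) := by
    have e : (1 + (a ^ 2 - p) * -v) * (algebraMap ℂ A (μ ^ 2) - p)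
        = (algebraMap ℂ A μ - a) * (algebraMap ℂ A μ + a) := by
      have hc : a * algebraMap ℂ A μ = algebraMap ℂ A μ * a := (Algebra.commutes μ a).symm
      rw [add_mul, mul_neg, neg_mul, mul_assoc, hvm', map_pow]
      simp only [sub_mul, mul_add, hc]
      noncomm_ring
    rw [← e]
    exact hu.mul ⟨⟨_, v, hvm, hvm'⟩, rfl⟩
  have hcomm : Commute (algebraMap ℂ A μ - a) (algebraMap ℂ A μ + a) := by
    have hc : Commute (algebraMap ℂ A μ) a := Algebra.commutes μ a
    exact ((Commute.refl _).add_right hc).sub_left (hc.symm.add_right (Commute.refl a))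
  exact (hcomm.isUnit_mul_iff.mp hprod).1

theorem stmt18 {A : Type*} [NormedRing A] [NormedAlgebra ℂ A] [CompleteSpace A] (a b : A)
    (ha : ∃ x, IsGenHiranoInv a x) (hb : ∃ x, IsGenHiranoInv b x)
    (h : a * b = 0) :
    ∃ x, IsGenHiranoInv (a + b) x := by
  
  obtain ⟨x, hx⟩ := ha
  obtain ⟨y, hy⟩ := hb
  apply exists_hirano
  intro μ h0 h1
  have hA := hirano_unit a x hx μ h0 h1
  have hB := hirano_unit b y hy μ h0 h1
  have hAB := hA.mul hB
  have e : (algebraMap ℂ A μ - a) * (algebraMap ℂ A μ - b)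
      = algebraMap ℂ A μ * (algebraMap ℂ A μ - (a + b)) := by
    have hc : a * algebraMap ℂ A μ = algebraMap ℂ A μ * a := (Algebra.commutes μ a).symm
    simp only [sub_mul, mul_sub, mul_add, h, hc]
    abel
  rw [e] at hAB
  have hu : IsUnit (algebraMap ℂ A μ) := (IsUnit.mk0 μ h0).map _
  obtain ⟨u, hu⟩ := hu
  rw [← hu] at hAB
  rw [← hu]
  exact (Units.isUnit_units_mul u _).mp hAB
end

section
/- Let X be a complex Banach space and let A, D ∈ L(X) each have a generalized Hirano inverse in L(X). Then for any B ∈ L(X), the 2 × 2 operator matrix [[A, B], [0, D]] has a generalized Hirano inverse in the ring M₂(L(X)) of 2 × 2 matrices over L(X). -/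
section helpers

variable {R : Type*} [NormedRing R] [NormedAlgebra ℂ R] [CompleteSpace R]

theorem aux_summable (w : R) (hw : ∀ l : ℂ, IsUnit (1 + l • w)) (r : ℝ) (hr : 0 ≤ r) :
    Summable (fun n : ℕ => r ^ n * ‖w ^ n‖) := by
  have hs : spectralRadius ℂ w = 0 := by
    rw [← nonpos_iff_eq_zero]
    refine iSup₂_le fun k hk => ?_
    by_cases h0 : k = 0
    · simp [h0]
    · exfalso
      apply hk
      have h1 := hw (-k⁻¹)
      have h2 : (algebraMap ℂ R k - w) = algebraMap ℂ R k * (1 + (-k⁻¹) • w) := by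
        rw [mul_add, mul_one, ← Algebra.smul_def, smul_smul, mul_neg, mul_inv_cancel₀ h0]
        simp [sub_eq_add_neg]
      rw [spectrum.mem_resolventSet_iff, h2]
      exact ((isUnit_iff_ne_zero.mpr h0).map (algebraMap ℂ R)).mul h1
  have ht := spectrum.pow_norm_pow_one_div_tendsto_nhds_spectralRadius w
  rw [hs] at ht
  have hpos : 0 < (2 * (r + 1))⁻¹ := by positivity
  have he := ht.eventually_lt_const (u := ENNReal.ofReal (2 * (r + 1))⁻¹) (by simpa using hpos)
  have hg : Summable (fun n : ℕ => (1 / 2 : ℝ) ^ n) := summable_geometric_two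
  refine Summable.of_norm_bounded_eventually_nat hg ?_
  filter_upwards [he, Filter.eventually_gt_atTop 0] with n hn hn0
  rw [ENNReal.ofReal_lt_ofReal_iff hpos] at hn
  have h3 : ‖w ^ n‖ ≤ ((2 * (r + 1))⁻¹) ^ n := by
    have h4 := pow_le_pow_left₀ (by positivity) hn.le n
    rwa [one_div, Real.rpow_inv_natCast_pow (norm_nonneg _) hn0.ne'] at h4
  rw [Real.norm_of_nonneg (by positivity)]
  calc r ^ n * ‖w ^ n‖ ≤ r ^ n * ((2 * (r + 1))⁻¹) ^ n := by gcongr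
    _ = (r * (2 * (r + 1))⁻¹) ^ n := by rw [mul_pow]
    _ ≤ (1 / 2) ^ n := by
      gcongr
      rw [← div_eq_mul_inv, div_le_div_iff₀ (by positivity) (by positivity)]
      linarith

theorem aux_qnil (w : R) (hw : ∀ l : ℂ, IsUnit (1 + l • w)) : Quasinilpotent w := by
  intro x hx
  have hs := (aux_summable w hw ‖x‖ (norm_nonneg x)).tendsto_atTop_zero
  obtain ⟨n, hn, hn0⟩ := ((hs.eventually_lt_const one_pos).and
    (Filter.eventually_gt_atTop 0)).exists
  have hc : Commute w x := hx.symm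
  have h1 : ‖(-(w * x)) ^ n‖ < 1 := by
    refine lt_of_le_of_lt ?_ hn
    rw [neg_pow, hc.mul_pow]
    have h5 : ‖x ^ n‖ ≤ ‖x‖ ^ n := norm_pow_le' x hn0
    have h6 : ‖(-1 : R) ^ n * (w ^ n * x ^ n)‖ = ‖w ^ n * x ^ n‖ := by
      rcases neg_one_pow_eq_or R n with h | h <;> simp [h]
    rw [h6, mul_comm]
    exact (norm_mul_le _ _).trans (by gcongr)
  have h2 := isUnit_one_sub_of_norm_lt_one h1
  have h3 := mul_neg_geom_sum (-(w * x)) n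
  rw [← h3, sub_neg_eq_add] at h2
  refine ((Commute.isUnit_mul_iff ?_).mp h2).1
  refine Commute.sum_right _ _ _ fun i _ => ?_
  refine Commute.pow_right ?_ i
  exact (((Commute.one_left _).add_left (Commute.refl _))).neg_right

theorem aux_smul {w : R} (hw : Quasinilpotent w) (l : ℂ) : IsUnit (1 + l • w) := by
  have := hw (algebraMap ℂ R l) (Algebra.commutes l w)
  rwa [← Algebra.commutes, ← Algebra.smul_def] at this

/-- Sylvester type equation. -/
theorem aux_sylv (w : R) (hw : ∀ l : ℂ, IsUnit (1 + l • w)) (a c : R) :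
    (∃ z, z = c + a * z * w) ∧ (∃ z, z = c + w * z * a) := by
  have hs := (aux_summable w hw ‖a‖ (norm_nonneg a)).mul_right ‖c‖
  constructor
  · have h : Summable (fun n : ℕ => a ^ n * c * w ^ n) := by
      rw [← summable_nat_add_iff 1]
      rw [← summable_nat_add_iff 1] at hs
      refine Summable.of_norm_bounded hs fun n => ?_
      have h5 : ‖a ^ (n+1)‖ ≤ ‖a‖ ^ (n+1) := norm_pow_le' a n.succ_pos
      calc _ ≤ ‖a ^ (n+1)‖ * ‖c‖ * ‖w ^ (n+1)‖ := norm_mul₃_le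
        _ ≤ ‖a‖ ^ (n+1) * ‖c‖ * ‖w ^ (n+1)‖ := by gcongr
        _ = _ := by ring
    refine ⟨∑' n : ℕ, a ^ n * c * w ^ n, ?_⟩
    rw [← h.tsum_mul_left, ← (h.mul_left a).tsum_mul_right, h.tsum_eq_zero_add]
    simp only [pow_zero, one_mul, mul_one]
    congr 2
    ext n
    rw [pow_succ', pow_succ]
    simp only [mul_assoc]
  · have h : Summable (fun n : ℕ => w ^ n * c * a ^ n) := by
      rw [← summable_nat_add_iff 1]
      rw [← summable_nat_add_iff 1] at hs
      refine Summable.of_norm_bounded hs fun n => ?_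
      have h5 : ‖a ^ (n+1)‖ ≤ ‖a‖ ^ (n+1) := norm_pow_le' a n.succ_pos
      calc _ ≤ ‖w ^ (n+1)‖ * ‖c‖ * ‖a ^ (n+1)‖ := norm_mul₃_le
        _ ≤ ‖w ^ (n+1)‖ * ‖c‖ * ‖a‖ ^ (n+1) := by gcongr
        _ = _ := by ring
    refine ⟨∑' n : ℕ, w ^ n * c * a ^ n, ?_⟩
    rw [← h.tsum_mul_left, ← (h.mul_left w).tsum_mul_right, h.tsum_eq_zero_add]
    simp only [pow_zero, one_mul, mul_one]
    congr 2
    ext n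
    rw [pow_succ', pow_succ]
    simp only [mul_assoc]

theorem aux_part {a b : R} (h : IsGenHiranoInv a b) (l : ℂ) :
    IsUnit (1 + l • (a * (1 - a * b))) := by
  obtain ⟨h1, h2, h3⟩ := h
  have hp : a * b * (a * b) = a * b := by
    rw [mul_assoc, ← mul_assoc b a b, ← h1]
  have hpa : a * b * a = a * (a * b) := by rw [mul_assoc, ← h2]
  have h4 := h3 (algebraMap ℂ R (-(l ^ 2)) * (1 - a * b)) (by
    rw [mul_assoc, ← mul_assoc (a ^ 2 - a * b), ← Algebra.commutes, mul_assoc]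
    congr 1
    have hc : Commute (a * b) a := hpa
    exact ((Commute.one_left _).sub_left ((hc.pow_right 2).sub_right (Commute.refl _))).eq)
  have h5 : 1 + (a ^ 2 - a * b) * (algebraMap ℂ R (-(l ^ 2)) * (1 - a * b)) =
      (1 + l • (a * (1 - a * b))) * (1 - l • (a * (1 - a * b))) := by
    rw [← mul_assoc, ← Algebra.commutes, mul_assoc, ← Algebra.smul_def]
    have h6 : (a ^ 2 - a * b) * (1 - a * b) = (a * (1 - a * b)) * (a * (1 - a * b)) := by
      have e1 : (a * (1 - a * b)) * (a * (1 - a * b)) =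
        a * (a - a * b * a) * (1 - a * b) := by noncomm_ring
      have e2 : (a - a * b * a) = a * (1 - a * b) := by rw [hpa]; noncomm_ring
      have e3 : (1 - a * b) * (1 - a * b) = 1 - a * b - a * b + a * b * (a * b) := by
        noncomm_ring
      rw [hp] at e3
      rw [e1, e2, ← mul_assoc, mul_assoc (a * a), e3]
      have e4 : (a ^ 2 - a * b) * (1 - a * b) =
        a * a * (1 - a * b) - a * b + a * b * (a * b) := by noncomm_ring
      rw [e4, hp]
      noncomm_ring
    rw [h6]
    generalize a * (1 - a * b) = v
    rw [mul_sub, mul_one, add_mul, one_mul, smul_mul_smul_comm, neg_smul, pow_two]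
    abel
  rw [h5] at h4
  refine ((Commute.isUnit_mul_iff ?_).mp h4).1
  refine Commute.add_left (Commute.one_left _) ?_
  exact (Commute.one_right _).sub_right (Commute.refl _)

end helpers

theorem aux_build {S : Type*} [Ring S] (m p : S) (hp : p * p = p) (hc : m * p = p * m)
    (hq : Quasinilpotent (m ^ 2 - p)) : ∃ b, IsGenHiranoInv m b := by
  obtain ⟨u, hu⟩ := hq 1 (by simp)
  rw [mul_one] at hu
  have hup : (u : S) * p = m * m * p := by
    rw [hu, add_mul, sub_mul, hp, pow_two, one_mul]; abel
  have cm : Commute m (u : S) := by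
    rw [hu]
    exact (Commute.one_right _).add_right (((Commute.refl m).pow_right 2).sub_right hc)
  have cmi : m * (↑u⁻¹ : S) = ↑u⁻¹ * m := (Commute.units_inv_right cm).eq
  have hmb : m * (↑u⁻¹ * p * m) = p := by
    rw [mul_assoc, ← hc, ← mul_assoc, cmi, mul_assoc, ← mul_assoc m m p, ← hup, ← mul_assoc]
    simp
  have hbm : (↑u⁻¹ * p * m) * m = p := by
    have : p * m * m = m * m * p := by rw [← hc, mul_assoc, ← hc, mul_assoc]
    rw [mul_assoc, mul_assoc, ← mul_assoc p, this, ← hup, ← mul_assoc]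
    simp
  have hpu : Commute p (u : S) := by
    rw [hu]
    exact (Commute.one_right _).add_right
      ((Commute.pow_right (show Commute p m from hc.symm) 2).sub_right (Commute.refl p))
  have hpi : p * (↑u⁻¹ : S) = ↑u⁻¹ * p := (Commute.units_inv_right hpu).eq
  refine ⟨↑u⁻¹ * p * m, ?_, ?_, ?_⟩
  · rw [hbm, ← mul_assoc, ← mul_assoc, hpi, mul_assoc _ p p, hp]
  · rw [hmb, hbm]
  · rw [hmb]; exact hq

theorem aux_tri {S : Type*} [Ring S] {u v : S} (hu : IsUnit u) (hv : IsUnit v) (b : S) :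
    IsUnit (!![u, b; 0, v] : Matrix (Fin 2) (Fin 2) S) := by
  obtain ⟨u, rfl⟩ := hu
  obtain ⟨v, rfl⟩ := hv
  refine ⟨⟨_, !![↑u⁻¹, -(↑u⁻¹ * b * ↑v⁻¹); 0, ↑v⁻¹], ?_, ?_⟩, rfl⟩
  · simp [Matrix.mul_fin_two, Matrix.one_fin_two, mul_assoc]
  · simp [Matrix.mul_fin_two, Matrix.one_fin_two, mul_assoc]

section mat

attribute [local instance] Matrix.linftyOpNormedRing Matrix.linftyOpNormedAlgebra

theorem aux_mat_qnil {R : Type*} [NormedRing R] [NormedAlgebra ℂ R] [CompleteSpace R]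
    {a d : R} (ha : Quasinilpotent a) (hd : Quasinilpotent d) (b : R) :
    Quasinilpotent (!![a, b; 0, d] : Matrix (Fin 2) (Fin 2) R) := by
  have hcomp : @CompleteSpace (Matrix (Fin 2) (Fin 2) R)
      (Matrix.linftyOpNormedRing (n := Fin 2)
        (α := R)).toMetricSpace.toPseudoMetricSpace.toUniformSpace :=
    (inferInstance : CompleteSpace (Fin 2 → Fin 2 → R))
  refine @aux_qnil (Matrix (Fin 2) (Fin 2) R) Matrix.linftyOpNormedRing
    Matrix.linftyOpNormedAlgebra hcomp _ fun l => ?_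
  have := aux_tri (aux_smul ha l) (aux_smul hd l) (l • b)
  convert this using 1
  simp [Matrix.one_fin_two]

end mat

theorem aux_main {R : Type*} [NormedRing R] [NormedAlgebra ℂ R] [CompleteSpace R]
    {A D A' D' : R} (hA : IsGenHiranoInv A A') (hD : IsGenHiranoInv D D') (B : R) :
    ∃ M', IsGenHiranoInv (!![A, B; 0, D] : Matrix (Fin 2) (Fin 2) R) M' := by
  have wA := aux_part hA
  have wD := aux_part hD
  obtain ⟨a1, a2, a3⟩ := hA
  obtain ⟨d1, d2, d3⟩ := hD
  obtain ⟨p, hp⟩ : ∃ p, p = A * A' := ⟨_, rfl⟩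
  obtain ⟨q, hq⟩ : ∃ q, q = D * D' := ⟨_, rfl⟩
  rw [← hp] at wA a3
  rw [← hq] at wD d3
  have pA' : p * A' = A' := by rw [hp, a2, ← a1]
  have A'p : A' * p = A' := by rw [hp, ← mul_assoc, ← a1]
  have pA : p * A = A * p := by rw [hp, mul_assoc, ← a2]
  have D'q : D' * q = D' := by rw [hq, ← mul_assoc, ← d1]
  have qD : q * D = D * q := by rw [hq, mul_assoc, ← d2]
  have pp : p * p = p := by
    nth_rw 1 [hp]
    rw [mul_assoc, A'p, ← hp]
  have qq : q * q = q := by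
    nth_rw 1 [hq]
    rw [mul_assoc, D'q, ← hq]
  have D'D : D' * D = q := by rw [hq, d2]
  obtain ⟨z1, h1⟩ := (aux_sylv _ wD A' (A' * B * (1 - q))).1
  obtain ⟨z2, h2⟩ := (aux_sylv _ wA D' ((1 - p) * B * D')).2
  have qq' : (1 - q) * q = 0 := by rw [sub_mul, one_mul, qq, sub_self]
  have pp' : p * (1 - p) = 0 := by rw [mul_sub, mul_one, pp, sub_self]
  have z1p : p * z1 = z1 := by
    nth_rw 1 [h1]
    rw [mul_add]
    simp only [← mul_assoc]
    rw [pA']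
    simpa only [← mul_assoc] using h1.symm
  have z1q : z1 * q = 0 := by
    rw [h1, add_mul]
    simp only [mul_assoc]
    simp [qq']
  have z2p : p * z2 = 0 := by
    rw [h2, mul_add]
    simp only [← mul_assoc]
    rw [pA, mul_assoc A p, pp']
    simp
  have z2q : z2 * q = z2 := by
    nth_rw 1 [h2]
    rw [add_mul, mul_assoc _ D' q, mul_assoc _ D' q, D'q, ← h2]
  have e1 : A * z1 - z1 * D = p * B * (1 - q) := by
    have i1 : A * z1 = p * B * (1 - q) + p * z1 * (D * (1 - q)) := by
      nth_rw 1 [h1]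
      rw [mul_add, hp]
      simp only [mul_assoc]
    rw [i1, z1p, mul_sub D, mul_one, ← qD, mul_sub z1, ← mul_assoc z1 q, z1q]
    simp
  have e2 : A * z2 - z2 * D = -((1 - p) * B * q) := by
    have i1 : z2 * D = (1 - p) * B * q + A * (1 - p) * (z2 * q) := by
      nth_rw 1 [h2]
      rw [add_mul, ← D'D]
      simp only [mul_assoc]
    rw [i1, z2q, mul_assoc A, sub_mul 1 p z2, z2p]
    simp
  refine aux_build _ !![p, z1 + z2; 0, q] ?_ ?_ ?_
  · simp [Matrix.mul_fin_two, pp, qq, mul_add, add_mul, z1p, z1q, z2p, z2q]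
  · have e3 : A * (z1 + z2) + B * q = p * B + (z1 + z2) * D := by
      have : A * (z1 + z2) - (z1 + z2) * D = p * B * (1 - q) + -((1 - p) * B * q) := by
        rw [← e1, ← e2]; noncomm_ring
      rw [sub_eq_iff_eq_add] at this
      rw [this]
      noncomm_ring
    simp [Matrix.mul_fin_two, pA, qD, e3]
  · have : (!![A, B; 0, D] ^ 2 - !![p, z1 + z2; 0, q] : Matrix (Fin 2) (Fin 2) R) =
      !![A ^ 2 - p, A * B + B * D - (z1 + z2); 0, D ^ 2 - q] := by
      simp [pow_two, Matrix.mul_fin_two]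
    rw [this]
    exact aux_mat_qnil a3 d3 _

theorem stmt19 {X : Type*} [NormedAddCommGroup X] [NormedSpace ℂ X]
    [CompleteSpace X] (A D : X →L[ℂ] X)
    (hA : ∃ B', IsGenHiranoInv A B') (hD : ∃ B', IsGenHiranoInv D B')
    (B : X →L[ℂ] X) :
    ∃ M', IsGenHiranoInv (!![A, B; 0, D] : Matrix (Fin 2) (Fin 2) (X →L[ℂ] X)) M' := by
  obtain ⟨A', hA⟩ := hA
  obtain ⟨D', hD⟩ := hD
  exact aux_main hA hD B
end
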